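/- arXiv:1107.0707 — 2 statements merged into one kernel-verified Lean document; each statement's English description precedes it below -/
import Mathlib

section
/- Let Y be a metric space and (Y_n^y)_{n∈ℕ₀} a family of Markov chains indexed by the starting point y ∈ Y with common transition probability function {π_y : y ∈ Y}, and let V : Y → [0,∞) be a Lyapunov function for {π_y} which is bounded on bounded sets. Assume there is a bounded measurable set A ⊂ Y and constants λ ∈ (0,1), C_ρ > 0 such that for ρ((y_n)) = inf{n ≥ 1 : y_n ∈ A} one has E_y λ^{-ρ} ≤ C_ρ(V(y)+1) for all y ∈ Y. Assume further there is a measurable set B ⊂ Y and constants p > 0, β ∈ (0,1), C_ε > 0 such that, with ε((y_n)) = inf{n ≥ 1 : y_n ∉ B}, one has P_y({(y_n) : y_n ∈ B for all n ≥ 1}) > p and E_y 1_{{ε<∞}} β^{-ε} ≤ C_ε for every y ∈ A. Then there exist γ ∈ (0,1) and C > 0 such that for τ((y_n)) = inf{n ≥ 1 : y_k ∈ B for all k ≥ n} one has E_y γ^{-τ} ≤ C(V(y)+1) for all y ∈ Y. -/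
open MeasureTheory ProbabilityTheory Filter Set
open scoped ENNReal NNReal

noncomputable section

/-- `geomInv t n = (t⁻¹)^n`, i.e. `t^{-n}`, with value `∞` at `n = ∞`. -/
def geomInv (t : ℝ) (n : ℕ∞) : ℝ≥0∞ :=
  if n = ⊤ then ⊤ else ENNReal.ofReal (t⁻¹ ^ n.toNat)

/-- Prepend a point to a path. -/
def prepend {Y : Type*} (y : Y) (ω : ℕ → Y) : ℕ → Y :=
  fun n => Nat.casesOn n y ω

/-- The path seen from time `m` on. -/
def pathShift {Y : Type*} (m : ℕ) (ω : ℕ → Y) : ℕ → Y := fun k => ω (m + k)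

/-- The first time `n ≥ 1` at which a path is in `S`. -/
def hitTime {Y : Type*} (S : Set Y) (ω : ℕ → Y) : ℕ∞ :=
  ⨅ n ∈ {n : ℕ | 1 ≤ n ∧ ω n ∈ S}, (n : ℕ∞)

/-- The first time `n ≥ 1` from which on a path stays in `S`. -/
def settleTime {Y : Type*} (S : Set Y) (ω : ℕ → Y) : ℕ∞ :=
  ⨅ n ∈ {n : ℕ | 1 ≤ n ∧ ∀ k : ℕ, n ≤ k → ω k ∈ S}, (n : ℕ∞)

/-- `P y` is the law of the Markov chain with transition kernel `π` started at `y`. -/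
structure IsPathFamily {Y : Type*} [MeasurableSpace Y] (π : Kernel Y Y)
    (P : Y → Measure (ℕ → Y)) : Prop where
  measurable : Measurable P
  isProbabilityMeasure : ∀ y, IsProbabilityMeasure (P y)
  map_prepend : ∀ y, P y = ((π y).bind P).map (prepend y)

section Times

lemma biInf_natCast_eq_top_iff (s : Set ℕ) :
    (⨅ n ∈ s, (n : ℕ∞)) = ⊤ ↔ ∀ n, n ∉ s := by
  simp [iInf_eq_top]

lemma biInf_natCast_eq_natCast_iff (s : Set ℕ) (n : ℕ) :
    (⨅ k ∈ s, (k : ℕ∞)) = n ↔ n ∈ s ∧ ∀ k < n, k ∉ s := by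
  constructor
  · intro h
    have hlt : ∀ k < n, k ∉ s := by
      intro k hk hks
      have : (⨅ k ∈ s, (k : ℕ∞)) ≤ k := iInf₂_le k hks
      rw [h] at this
      exact absurd (Nat.cast_le.mp this) (by omega)
    refine ⟨?_, hlt⟩
    by_contra hn
    have : ((n + 1 : ℕ) : ℕ∞) ≤ ⨅ k ∈ s, (k : ℕ∞) := by
      refine le_iInf₂ fun k hk => Nat.cast_le.mpr ?_
      rcases lt_trichotomy k n with h1 | h1 | h1
      · exact absurd hk (hlt k h1)
      · exact absurd (h1 ▸ hk) hn
      · omega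
    rw [h] at this
    exact absurd (Nat.cast_le.mp this) (by omega)
  · rintro ⟨hn, hlt⟩
    refine le_antisymm (iInf₂_le n hn) (le_iInf₂ fun k hk => Nat.cast_le.mpr ?_)
    by_contra hk'
    exact hlt k (by omega) hk

lemma measurable_biInf_natCast {Ω : Type*} [MeasurableSpace Ω] {Q : ℕ → Ω → Prop}
    (hQ : ∀ n, MeasurableSet {ω | Q n ω}) :
    Measurable fun ω => ⨅ n ∈ {n : ℕ | Q n ω}, (n : ℕ∞) := by
  refine measurable_to_countable' fun x => ?_
  induction x using ENat.recTopCoe with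
  | top =>
    have : (fun ω => ⨅ n ∈ {n : ℕ | Q n ω}, (n : ℕ∞)) ⁻¹' {⊤} = ⋂ n, {ω | Q n ω}ᶜ := by
      ext ω
      simp only [mem_preimage, mem_singleton_iff, biInf_natCast_eq_top_iff, mem_iInter]
      rfl
    rw [this]
    exact MeasurableSet.iInter fun n => (hQ n).compl
  | coe n =>
    have : (fun ω => ⨅ n ∈ {n : ℕ | Q n ω}, (n : ℕ∞)) ⁻¹' {(n : ℕ∞)}
        = {ω | Q n ω} ∩ ⋂ k, ⋂ (_ : k < n), {ω | Q k ω}ᶜ := by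
      ext ω
      simp only [mem_preimage, mem_singleton_iff, biInf_natCast_eq_natCast_iff, mem_inter_iff,
        mem_iInter]
      rfl
    rw [this]
    exact (hQ n).inter (MeasurableSet.iInter fun k => MeasurableSet.iInter fun _ => (hQ k).compl)

variable {Y : Type*}

lemma hitTime_eq_top_iff {S : Set Y} {ω : ℕ → Y} :
    hitTime S ω = ⊤ ↔ ∀ n, 1 ≤ n → ω n ∉ S := by
  simp [hitTime]

lemma hitTime_eq_natCast_iff {S : Set Y} {ω : ℕ → Y} {n : ℕ} :
    hitTime S ω = n ↔ (1 ≤ n ∧ ω n ∈ S) ∧ ∀ k < n, 1 ≤ k → ω k ∉ S := by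
  rw [hitTime, biInf_natCast_eq_natCast_iff]
  simp only [mem_ofPred_eq, not_and]

/-- Whether a path hits `S` at time `n` is decided by its values up to time `n`. -/
lemma hitTime_eq_natCast_congr {S : Set Y} {ω ω' : ℕ → Y} {n : ℕ}
    (h : ∀ k ≤ n, ω k = ω' k) : hitTime S ω = n ↔ hitTime S ω' = n := by
  rw [hitTime_eq_natCast_iff, hitTime_eq_natCast_iff, h n le_rfl]
  refine and_congr_right fun _ => forall₂_congr fun k hk => ?_
  rw [h k hk.le]

lemma settleTime_le_add (S : Set Y) (ω : ℕ → Y) (m : ℕ) :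
    settleTime S ω ≤ m + settleTime S (pathShift m ω) := by
  by_cases htop : settleTime S (pathShift m ω) = ⊤
  · simp [htop]
  · obtain ⟨n, h⟩ := ENat.ne_top_iff_exists.mp htop
    rw [← h]
    obtain ⟨⟨h1, h2⟩, -⟩ := (biInf_natCast_eq_natCast_iff _ n).mp h.symm
    have : ((m + n : ℕ) : ℕ∞) = m + n := by push_cast; rfl
    rw [← this]
    refine iInf₂_le (m + n) ⟨by omega, fun k hk => ?_⟩
    have := h2 (k - m) (by omega)
    simpa [pathShift, show m + (k - m) = k by omega] using this

lemma settleTime_le_one {S : Set Y} {ω : ℕ → Y} (h : ∀ n, 1 ≤ n → ω n ∈ S) :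
    settleTime S ω ≤ 1 := by
  exact_mod_cast iInf₂_le (f := fun (n : ℕ) (_ : n ∈ {n : ℕ | 1 ≤ n ∧ ∀ k : ℕ, n ≤ k → ω k ∈ S})
    => (n : ℕ∞)) 1 ⟨le_rfl, h⟩

variable [MeasurableSpace Y]

lemma measurable_pathShift (m : ℕ) : Measurable (pathShift m : (ℕ → Y) → ℕ → Y) :=
  measurable_pi_lambda _ fun k => measurable_pi_apply (m + k)

lemma measurable_prepend (y : Y) : Measurable (prepend y) := by
  refine measurable_pi_lambda _ fun k => ?_
  cases k with
  | zero => exact measurable_const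
  | succ k => exact measurable_pi_apply k

lemma measurable_hitTime {S : Set Y} (hS : MeasurableSet S) : Measurable (hitTime S) := by
  refine measurable_biInf_natCast fun n => ?_
  exact (MeasurableSet.const _).inter (measurable_pi_apply n hS)

lemma measurable_settleTime {S : Set Y} (hS : MeasurableSet S) : Measurable (settleTime S) := by
  refine measurable_biInf_natCast fun n => ?_
  have h : {ω : ℕ → Y | ∀ k, n ≤ k → ω k ∈ S} = ⋂ k, ⋂ (_ : n ≤ k), {ω | ω k ∈ S} := by
    ext ω
    simp only [mem_iInter]
    rfl
  have hm : MeasurableSet {ω : ℕ → Y | ∀ k, n ≤ k → ω k ∈ S} := by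
    rw [h]
    exact MeasurableSet.iInter fun k => MeasurableSet.iInter fun _ => measurable_pi_apply k hS
  exact (MeasurableSet.const _).inter hm

end Times

section GeomInv

lemma geomInv_top (t : ℝ) : geomInv t ⊤ = ⊤ := by simp [geomInv]

lemma geomInv_natCast {t : ℝ} (ht : 0 < t) (n : ℕ) :
    geomInv t n = ENNReal.ofReal t⁻¹ ^ n := by
  rw [geomInv, if_neg (ENat.natCast_ne_top n), ENat.toNat_natCast,
    ENNReal.ofReal_pow (inv_nonneg.mpr ht.le)]

lemma one_le_ofReal_inv {t : ℝ} (ht : t ∈ Ioo (0 : ℝ) 1) : 1 ≤ ENNReal.ofReal t⁻¹ := by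
  rw [ENNReal.one_le_ofReal]
  exact (one_le_inv₀ ht.1).mpr ht.2.le

lemma geomInv_mono {t : ℝ} (ht : t ∈ Ioo (0 : ℝ) 1) : Monotone (geomInv t) := by
  intro m n hmn
  induction n using ENat.recTopCoe with
  | top => simp [geomInv_top]
  | coe n =>
    lift m to ℕ using (hmn.trans_lt (ENat.natCast_lt_top n)).ne
    rw [geomInv_natCast ht.1, geomInv_natCast ht.1]
    exact pow_le_pow_right₀ (one_le_ofReal_inv ht) (Nat.cast_le.mp hmn)

lemma geomInv_anti {s t : ℝ} (hs : 0 < s) (hst : s ≤ t) (n : ℕ∞) : geomInv t n ≤ geomInv s n := by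
  induction n using ENat.recTopCoe with
  | top => simp [geomInv_top]
  | coe n =>
    rw [geomInv_natCast hs, geomInv_natCast (hs.trans_le hst)]
    gcongr

lemma geomInv_natCast_add {t : ℝ} (ht : 0 < t) (m : ℕ) (n : ℕ∞) :
    geomInv t (m + n) = ENNReal.ofReal t⁻¹ ^ m * geomInv t n := by
  induction n using ENat.recTopCoe with
  | top =>
    have : ENNReal.ofReal t⁻¹ ^ m ≠ 0 := pow_ne_zero _ (by simpa using ht)
    simp [geomInv_top, ENNReal.mul_top this]
  | coe n =>
    rw [← Nat.cast_add, geomInv_natCast ht, geomInv_natCast ht, pow_add]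

/-- Convexity of `x ↦ x ^ n`: the weight `t⁻¹ = 1 + θ (s⁻¹ - 1)` interpolates between `1` and
`s⁻¹`. -/
lemma geomInv_le_interpolate {s t θ : ℝ} (hs : 0 < s) (ht : 0 < t) (hθ : θ ∈ Ioo (0 : ℝ) 1)
    (h : t⁻¹ = 1 - θ + θ * s⁻¹) (n : ℕ∞) :
    geomInv t n ≤ ENNReal.ofReal (1 - θ) + ENNReal.ofReal θ * geomInv s n := by
  induction n using ENat.recTopCoe with
  | top =>
    have : ENNReal.ofReal θ ≠ 0 := by simpa using hθ.1
    simp [geomInv_top, ENNReal.mul_top this]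
  | coe n =>
    have h1 : 0 ≤ s⁻¹ := inv_nonneg.mpr hs.le
    rw [geomInv_natCast ht, geomInv_natCast hs, ← ENNReal.ofReal_pow h1,
      ← ENNReal.ofReal_pow (inv_nonneg.mpr ht.le), ← ENNReal.ofReal_mul hθ.1.le,
      ← ENNReal.ofReal_add (sub_nonneg.mpr hθ.2.le) (mul_nonneg hθ.1.le (pow_nonneg h1 n))]
    apply ENNReal.ofReal_le_ofReal
    have := (convexOn_pow (𝕜 := ℝ) n).2 (x := 1) (by simp) (y := s⁻¹) h1
      (sub_nonneg.mpr hθ.2.le) hθ.1.le (by ring)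
    simpa [h] using this

/-- With `s ≤ t ^ 4`, a product of weights is controlled by the weights of the factors separately,
at the price of a factor that is summable in `n`. -/
lemma pow_mul_geomInv_le {r s t : ℝ} (hr : 0 < r) (hs : 0 < s) (ht : t ∈ Ioo (0 : ℝ) 1)
    (hrt : r ≤ t ^ 4) (hst : s ≤ t ^ 4) (n : ℕ) (k : ℕ∞) :
    ENNReal.ofReal t⁻¹ ^ n * geomInv t k ≤ geomInv r n + ENNReal.ofReal t ^ n * geomInv s k := by
  have ht0 := ht.1
  induction k using ENat.recTopCoe with
  | top =>
    have : ENNReal.ofReal t ^ n ≠ 0 := pow_ne_zero _ (by simpa using ht0)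
    simp [geomInv_top, ENNReal.mul_top this]
  | coe k =>
    have h1 : 1 ≤ t⁻¹ := (one_le_inv₀ ht0).mpr ht.2.le
    have hinv : ∀ u : ℝ, 0 < u → u ≤ t ^ 4 → (t⁻¹) ^ 4 ≤ u⁻¹ := fun u hu hut => by
      rw [inv_pow]; exact inv_anti₀ hu hut
    have h2 := hinv r hr hrt
    have h3 := hinv s hs hst
    rw [geomInv_natCast hr, geomInv_natCast hs, geomInv_natCast ht0,
      ← ENNReal.ofReal_pow (by positivity), ← ENNReal.ofReal_pow (by positivity),
      ← ENNReal.ofReal_pow (by positivity), ← ENNReal.ofReal_pow (by positivity),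
      ← ENNReal.ofReal_pow (by positivity), ← ENNReal.ofReal_mul (by positivity),
      ← ENNReal.ofReal_mul (by positivity), ← ENNReal.ofReal_add (by positivity) (by positivity),
      ← pow_add]
    apply ENNReal.ofReal_le_ofReal
    by_cases hk : k ≤ 3 * n
    · calc t⁻¹ ^ (n + k) ≤ t⁻¹ ^ (4 * n) := pow_le_pow_right₀ h1 (by omega)
        _ = (t⁻¹ ^ 4) ^ n := pow_mul _ _ _
        _ ≤ r⁻¹ ^ n := by gcongr
        _ ≤ _ := le_add_of_nonneg_right (by positivity)
    · calc t⁻¹ ^ (n + k) ≤ t⁻¹ ^ (4 * k - n) := pow_le_pow_right₀ h1 (by omega)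
        _ = t ^ n * (t⁻¹ ^ 4) ^ k := by
          rw [← pow_mul, show 4 * k = n + (4 * k - n) by omega, pow_add, ← mul_assoc, ← mul_pow,
            mul_inv_cancel₀ ht0.ne', one_pow, one_mul]
          congr 1; omega
        _ ≤ t ^ n * s⁻¹ ^ k := by gcongr
        _ ≤ _ := le_add_of_nonneg_left (by positivity)

end GeomInv

section Excursion

variable {Y : Type*} {S A : Set Y} {ω : ℕ → Y}

/-- The weight `t ^ (-T)`, where `T` is the first visit to `A` after the first visit to `S`; the
weight is `0` if `S` is not visited. -/
def excursionWeight (t : ℝ) (S A : Set Y) (ω : ℕ → Y) : ℝ≥0∞ :=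
  ∑' n : ℕ, (if hitTime S ω = n then ENNReal.ofReal t⁻¹ ^ n else 0)
    * geomInv t (hitTime A (pathShift n ω))

lemma tsum_hitTime_eq {c : ℕ → ℝ≥0∞} {F : (ℕ → Y) → ℝ≥0∞} {n : ℕ} (h : hitTime S ω = n) :
    ∑' m : ℕ, (if hitTime S ω = m then c m else 0) * F (pathShift m ω)
      = c n * F (pathShift n ω) := by
  rw [tsum_eq_single n fun m hm => ?_, if_pos h]
  rw [if_neg fun h' => hm (Nat.cast_injective (h'.symm.trans h)), zero_mul]

lemma excursionWeight_of_eq_top {t : ℝ} (h : hitTime S ω = ⊤) : excursionWeight t S A ω = 0 := by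
  simp [excursionWeight, h]

lemma excursionWeight_of_eq_natCast {t : ℝ} (ht : 0 < t) {n : ℕ} (h : hitTime S ω = n) :
    excursionWeight t S A ω = geomInv t (n + hitTime A (pathShift n ω)) := by
  rw [excursionWeight, tsum_hitTime_eq (F := fun ω => geomInv t (hitTime A ω)) h,
    geomInv_natCast_add ht]

variable [MeasurableSpace Y]

lemma measurable_geomInv_hitTime (t : ℝ) (hA : MeasurableSet A) :
    Measurable fun ω => geomInv t (hitTime A ω) :=
  (Measurable.of_discrete (f := geomInv t)).comp (measurable_hitTime hA)

lemma measurable_ite_hitTime (hS : MeasurableSet S) (n : ℕ) (c : ℝ≥0∞) :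
    Measurable fun ω => if hitTime S ω = n then c else 0 :=
  Measurable.ite (measurable_hitTime hS (measurableSet_singleton _)) measurable_const
    measurable_const

lemma measurable_excursionWeight (t : ℝ) (hS : MeasurableSet S) (hA : MeasurableSet A) :
    Measurable (excursionWeight t S A) :=
  Measurable.tsum fun n => (measurable_ite_hitTime hS n _).mul
    ((measurable_geomInv_hitTime t hA).comp (measurable_pathShift n))

lemma lintegral_excursionWeight_le_interpolate (μ : Measure (ℕ → Y)) {s t θ : ℝ} (hs : 0 < s)
    (ht : 0 < t) (hθ : θ ∈ Ioo (0 : ℝ) 1) (h : t⁻¹ = 1 - θ + θ * s⁻¹)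
    (hA : MeasurableSet A) (hS : MeasurableSet S) :
    ∫⁻ ω, excursionWeight t S A ω ∂μ
      ≤ ENNReal.ofReal (1 - θ) * μ {ω | hitTime S ω ≠ ⊤}
        + ENNReal.ofReal θ * ∫⁻ ω, excursionWeight s S A ω ∂μ := by
  have hset : MeasurableSet {ω : ℕ → Y | hitTime S ω ≠ ⊤} :=
    (measurable_hitTime hS (measurableSet_singleton ⊤)).compl
  rw [← lintegral_const_mul _ (measurable_excursionWeight s hS hA),
    ← lintegral_indicator_const hset,
    ← lintegral_add_left (measurable_const.indicator hset)]
  refine lintegral_mono fun ω => ?_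
  by_cases htop : hitTime S ω = ⊤
  · simp [excursionWeight_of_eq_top htop]
  · obtain ⟨n, hn⟩ := ENat.ne_top_iff_exists.mp htop
    rw [excursionWeight_of_eq_natCast ht hn.symm, excursionWeight_of_eq_natCast hs hn.symm,
      indicator_of_mem htop]
    exact geomInv_le_interpolate hs ht hθ h _

end Excursion

namespace IsPathFamily

variable {Y : Type*} [MeasurableSpace Y] {π : Kernel Y Y} {P : Y → Measure (ℕ → Y)}

lemma measurable_lintegral (hP : IsPathFamily π P) {F : (ℕ → Y) → ℝ≥0∞} (hF : Measurable F) :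
    Measurable fun y => ∫⁻ ω, F ω ∂P y :=
  (Measure.measurable_lintegral hF).comp hP.measurable

lemma lintegral_eq (hP : IsPathFamily π P) {F : (ℕ → Y) → ℝ≥0∞} (hF : Measurable F) (y : Y) :
    ∫⁻ ω, F ω ∂P y = ∫⁻ x, ∫⁻ ω, F (prepend y ω) ∂P x ∂π y := by
  conv_lhs => rw [hP.map_prepend y]
  rw [lintegral_map hF (measurable_prepend y)]
  exact Measure.lintegral_bind hP.measurable.aemeasurable
    (hF.comp (measurable_prepend y)).aemeasurable

variable [IsMarkovKernel π]

/-- The Markov property at a fixed time `n`. -/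
lemma lintegral_mul_comp_pathShift (hP : IsPathFamily π P) {G : (ℕ → Y) → ℝ≥0∞}
    (hG : Measurable G) (n : ℕ) {H : (ℕ → Y) → ℝ≥0∞} (hH : Measurable H)
    (hHn : ∀ ω ω', (∀ k ≤ n, ω k = ω' k) → H ω = H ω') (y : Y) :
    ∫⁻ ω, H ω * G (pathShift n ω) ∂P y = ∫⁻ ω, H ω * ∫⁻ ω', G ω' ∂P (ω n) ∂P y := by
  have hL : ∀ n, Measurable fun ω : ℕ → Y => ∫⁻ ω', G ω' ∂P (ω n) := fun n =>
    (hP.measurable_lintegral hG).comp (measurable_pi_apply n)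
  have hHG : Measurable fun ω => H ω * G (pathShift n ω) :=
    hH.mul (hG.comp (measurable_pathShift n))
  have hHL : Measurable fun ω => H ω * ∫⁻ ω', G ω' ∂P (ω n) := hH.mul (hL n)
  induction n generalizing H y with
  | zero =>
    have := hP.isProbabilityMeasure
    have hconst : ∀ ω, H (prepend y ω) = H fun _ => y := fun ω =>
      hHn _ _ fun k hk => by rw [Nat.le_zero.mp hk]; rfl
    rw [hP.lintegral_eq hHG, hP.lintegral_eq hHL]
    have hshift : ∀ ω : ℕ → Y, pathShift 0 ω = ω := fun ω => by
      funext k; simp [pathShift]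
    have hzero : ∀ ω : ℕ → Y, prepend y ω 0 = y := fun _ => rfl
    simp only [hconst, hshift, hzero, lintegral_const, measure_univ, mul_one]
    have hGy : Measurable fun ω => G (prepend y ω) := hG.comp (measurable_prepend y)
    rw [hP.lintegral_eq hG y, ← lintegral_const_mul _ (hP.measurable_lintegral hGy)]
    exact lintegral_congr fun x => lintegral_const_mul _ hGy
  | succ n ih =>
    rw [hP.lintegral_eq hHG, hP.lintegral_eq hHL]
    refine lintegral_congr fun x => ?_
    have hshift : ∀ ω : ℕ → Y, pathShift (n + 1) (prepend y ω) = pathShift n ω := fun ω => by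
      funext k
      simp only [pathShift, show n + 1 + k = (n + k) + 1 by omega]
      rfl
    simp only [hshift]
    have hHy := hH.comp (measurable_prepend y)
    refine ih hHy (fun ω ω' h => hHn _ _ fun k hk => ?_) x
      (hHy.mul (hG.comp (measurable_pathShift n))) (hHy.mul (hL n))
    cases k with
    | zero => rfl
    | succ k => exact h k (by omega)

lemma lintegral_comp_pathShift (hP : IsPathFamily π P) {G : (ℕ → Y) → ℝ≥0∞}
    (hG : Measurable G) (n : ℕ) (y : Y) :
    ∫⁻ ω, G (pathShift n ω) ∂P y = ∫⁻ ω, ∫⁻ ω', G ω' ∂P (ω n) ∂P y := by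
  simpa using hP.lintegral_mul_comp_pathShift hG n (H := fun _ => 1) measurable_const
    (fun _ _ _ => rfl) y

/-- The moments of a Lyapunov function along the chain are bounded uniformly in time. -/
lemma lintegral_lyapunov_le (hP : IsPathFamily π P) {V : Y → ℝ} (hV : Measurable V)
    (hV0 : ∀ y, 0 ≤ V y) {a b : ℝ} (ha : a ∈ Ioo (0 : ℝ) 1) (hb : 0 ≤ b)
    (hLyap : ∀ y, ∫⁻ x, ENNReal.ofReal (V x) ∂π y ≤ ENNReal.ofReal (a * V y + b)) (n : ℕ) (y : Y) :
    ∫⁻ ω, ENNReal.ofReal (V (ω n)) ∂P y ≤ ENNReal.ofReal (V y + b / (1 - a)) := by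
  have := hP.isProbabilityMeasure
  have ha' : 0 < 1 - a := sub_pos.mpr ha.2
  have hc : 0 ≤ b / (1 - a) := by positivity
  have hVm : ∀ n, Measurable fun ω : ℕ → Y => ENNReal.ofReal (V (ω n)) := fun n =>
    (hV.comp (measurable_pi_apply n)).ennreal_ofReal
  have hzero : ∀ y, ∫⁻ ω, ENNReal.ofReal (V (ω 0)) ∂P y = ENNReal.ofReal (V y) := fun y => by
    rw [hP.lintegral_eq (hVm 0)]
    have : ∀ ω : ℕ → Y, prepend y ω 0 = y := fun _ => rfl
    simp [this]
  have hone : ∀ y, ∫⁻ ω, ENNReal.ofReal (V (ω 1)) ∂P y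
      ≤ ENNReal.ofReal a * ENNReal.ofReal (V y) + ENNReal.ofReal b := fun y => by
    rw [hP.lintegral_eq (hVm 1), ← ENNReal.ofReal_mul ha.1.le,
      ← ENNReal.ofReal_add (mul_nonneg ha.1.le (hV0 y)) hb]
    refine le_trans (le_of_eq ?_) (hLyap y)
    exact lintegral_congr fun x => hzero x
  induction n with
  | zero => rw [hzero]; exact ENNReal.ofReal_le_ofReal (le_add_of_nonneg_right hc)
  | succ n ih =>
    calc ∫⁻ ω, ENNReal.ofReal (V (ω (n + 1))) ∂P y
        = ∫⁻ ω, ∫⁻ ω', ENNReal.ofReal (V (ω' 1)) ∂P (ω n) ∂P y :=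
          hP.lintegral_comp_pathShift (hVm 1) n y
      _ ≤ ∫⁻ ω, (ENNReal.ofReal a * ENNReal.ofReal (V (ω n)) + ENNReal.ofReal b) ∂P y :=
          lintegral_mono fun ω => hone (ω n)
      _ = ENNReal.ofReal a * ∫⁻ ω, ENNReal.ofReal (V (ω n)) ∂P y + ENNReal.ofReal b := by
          rw [lintegral_add_right _ measurable_const, lintegral_const_mul _ (hVm n)]
          simp
      _ ≤ ENNReal.ofReal a * ENNReal.ofReal (V y + b / (1 - a)) + ENNReal.ofReal b := by gcongr
      _ ≤ ENNReal.ofReal (V y + b / (1 - a)) := by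
          rw [← ENNReal.ofReal_mul ha.1.le,
            ← ENNReal.ofReal_add (mul_nonneg ha.1.le (add_nonneg (hV0 y) hc)) hb]
          apply ENNReal.ofReal_le_ofReal
          have h1 : a * (b / (1 - a)) + b = b / (1 - a) := by field_simp; ring
          nlinarith [hV0 y, ha.2]

/-- The part of the Markov property used at hitting times: on `{hitTime S = n}`. -/
lemma lintegral_hitTime_mul_comp_pathShift (hP : IsPathFamily π P) {G : (ℕ → Y) → ℝ≥0∞}
    (hG : Measurable G) {S : Set Y} (hS : MeasurableSet S) (n : ℕ) (c : ℝ≥0∞) (y : Y) :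
    ∫⁻ ω, (if hitTime S ω = n then c else 0) * G (pathShift n ω) ∂P y
      = ∫⁻ ω, (if hitTime S ω = n then c else 0) * ∫⁻ ω', G ω' ∂P (ω n) ∂P y := by
  refine hP.lintegral_mul_comp_pathShift hG n ?_ (fun ω ω' h => ?_) y
  · exact Measurable.ite (measurable_hitTime hS (measurableSet_singleton _)) measurable_const
      measurable_const
  · simp only [hitTime_eq_natCast_congr h]


variable {t : ℝ} {A S : Set Y} {G : (ℕ → Y) → ℝ≥0∞}

lemma lintegral_tsum_hitTime_mul_comp_pathShift (hP : IsPathFamily π P) (hG : Measurable G)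
    (hS : MeasurableSet S) (c : ℕ → ℝ≥0∞) (y : Y) :
    ∫⁻ ω, ∑' n : ℕ, (if hitTime S ω = n then c n else 0) * G (pathShift n ω) ∂P y
      = ∑' n : ℕ, ∫⁻ ω, (if hitTime S ω = n then c n else 0) * ∫⁻ ω', G ω' ∂P (ω n) ∂P y := by
  have hmeas : ∀ n : ℕ, Measurable fun ω =>
      (if hitTime S ω = n then c n else 0) * G (pathShift n ω) := fun n =>
    (measurable_ite_hitTime hS n _).mul (hG.comp (measurable_pathShift n))
  rw [lintegral_tsum fun n => (hmeas n).aemeasurable]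
  exact tsum_congr fun n => hP.lintegral_hitTime_mul_comp_pathShift hG hS n _ y

/-- A submultiplicative path functional whose expectation is at most `U` for starting points in
`A` is controlled from everywhere by the return time to `A`. -/
lemma lintegral_le_geomInv_hitTime_mul (hP : IsPathFamily π P) (ht : t ∈ Ioo (0 : ℝ) 1)
    (hA : MeasurableSet A) (hG : Measurable G)
    (hGshift : ∀ m ω, G ω ≤ ENNReal.ofReal t⁻¹ ^ m * G (pathShift m ω))
    {U : ℝ≥0∞} (hU : ∀ x ∈ A, ∫⁻ ω, G ω ∂P x ≤ U) (y : Y)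
    (hfin : ∫⁻ ω, geomInv t (hitTime A ω) ∂P y ≠ ⊤) :
    ∫⁻ ω, G ω ∂P y ≤ (∫⁻ ω, geomInv t (hitTime A ω) ∂P y) * U := by
  have hlt : ∀ᵐ ω ∂P y, hitTime A ω ≠ ⊤ := by
    filter_upwards [ae_lt_top (measurable_geomInv_hitTime t hA) hfin] with ω h htop
    simp [htop, geomInv_top] at h
  calc ∫⁻ ω, G ω ∂P y
      ≤ ∫⁻ ω, ∑' n : ℕ, (if hitTime A ω = n then ENNReal.ofReal t⁻¹ ^ n else 0)
          * G (pathShift n ω) ∂P y := by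
        refine lintegral_mono_ae ?_
        filter_upwards [hlt] with ω h
        obtain ⟨n, hn⟩ := ENat.ne_top_iff_exists.mp h
        rw [tsum_hitTime_eq hn.symm]
        exact hGshift n ω
    _ = ∑' n : ℕ, ∫⁻ ω, (if hitTime A ω = n then ENNReal.ofReal t⁻¹ ^ n else 0)
          * ∫⁻ ω', G ω' ∂P (ω n) ∂P y :=
        hP.lintegral_tsum_hitTime_mul_comp_pathShift hG hA _ y
    _ ≤ ∑' n : ℕ, ∫⁻ ω, (if hitTime A ω = n then ENNReal.ofReal t⁻¹ ^ n else 0) * U ∂P y := by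
        refine ENNReal.tsum_le_tsum fun n => lintegral_mono fun ω => ?_
        by_cases h : hitTime A ω = n
        · simp only [h, if_true]
          gcongr
          exact hU _ (hitTime_eq_natCast_iff.mp h).1.2
        · simp [h]
    _ = (∫⁻ ω, ∑' n : ℕ, (if hitTime A ω = n then ENNReal.ofReal t⁻¹ ^ n else 0) * 1 ∂P y)
          * U := by
        simp only [mul_one]
        rw [lintegral_tsum fun n => (measurable_ite_hitTime hA n _).aemeasurable,
          ← ENNReal.tsum_mul_right]
        exact tsum_congr fun n => lintegral_mul_const _ (measurable_ite_hitTime hA n _)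
    _ ≤ (∫⁻ ω, geomInv t (hitTime A ω) ∂P y) * U := by
        gcongr with ω
        by_cases h : hitTime A ω = ⊤
        · simp [h]
        · obtain ⟨n, hn⟩ := ENat.ne_top_iff_exists.mp h
          rw [tsum_hitTime_eq (c := fun n => ENNReal.ofReal t⁻¹ ^ n) (F := fun _ => 1) hn.symm,
            ← hn, geomInv_natCast ht.1, mul_one]

/-- Expectations of submultiplicative path functionals along one excursion. -/
lemma lintegral_le_add_excursionWeight_mul (hP : IsPathFamily π P) (ht : t ∈ Ioo (0 : ℝ) 1)
    (hA : MeasurableSet A) (hS : MeasurableSet S) (hG : Measurable G)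
    (hGshift : ∀ m ω, G ω ≤ ENNReal.ofReal t⁻¹ ^ m * G (pathShift m ω))
    {c : ℝ≥0∞} (hGtop : ∀ ω, hitTime S ω = ⊤ → G ω ≤ c)
    (hfin : ∀ y, ∫⁻ ω, geomInv t (hitTime A ω) ∂P y ≠ ⊤)
    {U : ℝ≥0∞} (hU : ∀ x ∈ A, ∫⁻ ω, G ω ∂P x ≤ U) (y : Y) :
    ∫⁻ ω, G ω ∂P y ≤ c + (∫⁻ ω, excursionWeight t S A ω ∂P y) * U := by
  have := hP.isProbabilityMeasure
  have hW := measurable_geomInv_hitTime t hA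
  have hLW : ∀ n : ℕ, Measurable fun ω : ℕ → Y =>
      ∫⁻ ω', geomInv t (hitTime A ω') ∂P (ω n) := fun n =>
    (hP.measurable_lintegral hW).comp (measurable_pi_apply n)
  calc ∫⁻ ω, G ω ∂P y
      ≤ ∫⁻ ω, c + ∑' n : ℕ, (if hitTime S ω = n then ENNReal.ofReal t⁻¹ ^ n else 0)
          * G (pathShift n ω) ∂P y := by
        refine lintegral_mono fun ω => ?_
        by_cases h : hitTime S ω = ⊤
        · exact (hGtop ω h).trans le_self_add
        · obtain ⟨n, hn⟩ := ENat.ne_top_iff_exists.mp h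
          rw [tsum_hitTime_eq hn.symm]
          exact (hGshift n ω).trans le_add_self
    _ = c + ∑' n : ℕ, ∫⁻ ω, (if hitTime S ω = n then ENNReal.ofReal t⁻¹ ^ n else 0)
          * ∫⁻ ω', G ω' ∂P (ω n) ∂P y := by
        rw [lintegral_add_left measurable_const,
          hP.lintegral_tsum_hitTime_mul_comp_pathShift hG hS]
        simp
    _ ≤ c + ∑' n : ℕ, ∫⁻ ω, ((if hitTime S ω = n then ENNReal.ofReal t⁻¹ ^ n else 0)
          * ∫⁻ ω', geomInv t (hitTime A ω') ∂P (ω n)) * U ∂P y := by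
        refine add_le_add_right (ENNReal.tsum_le_tsum fun n => lintegral_mono fun ω => ?_) c
        rw [mul_assoc]
        gcongr
        exact hP.lintegral_le_geomInv_hitTime_mul ht hA hG hGshift hU _ (hfin _)
    _ = c + (∑' n : ℕ, ∫⁻ ω, ((if hitTime S ω = n then ENNReal.ofReal t⁻¹ ^ n else 0)
          * ∫⁻ ω', geomInv t (hitTime A ω') ∂P (ω n)) ∂P y) * U := by
        rw [← ENNReal.tsum_mul_right]
        congr 1
        exact tsum_congr fun n => lintegral_mul_const _
          ((measurable_ite_hitTime hS n _).mul (hLW n))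
    _ = c + (∫⁻ ω, excursionWeight t S A ω ∂P y) * U := by
        rw [← hP.lintegral_tsum_hitTime_mul_comp_pathShift hW hS]
        rfl

lemma lintegral_excursionWeight_le (hP : IsPathFamily π P) {r s : ℝ} (hr : 0 < r) (hs : 0 < s)
    (ht : t ∈ Ioo (0 : ℝ) 1) (hrt : r ≤ t ^ 4) (hst : s ≤ t ^ 4) (hA : MeasurableSet A)
    {V : Y → ℝ} (hV : Measurable V) (hV0 : ∀ y, 0 ≤ V y) {a b : ℝ} (ha : a ∈ Ioo (0 : ℝ) 1)
    (hb : 0 ≤ b)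
    (hLyap : ∀ y, ∫⁻ x, ENNReal.ofReal (V x) ∂π y ≤ ENNReal.ofReal (a * V y + b))
    {C : ℝ} (hC : 0 ≤ C)
    (hρ : ∀ y, ∫⁻ ω, geomInv s (hitTime A ω) ∂P y ≤ ENNReal.ofReal (C * (V y + 1))) (y : Y) :
    ∫⁻ ω, excursionWeight t S A ω ∂P y
      ≤ ∫⁻ ω, (if hitTime S ω = ⊤ then 0 else geomInv r (hitTime S ω)) ∂P y
        + (1 - ENNReal.ofReal t)⁻¹
          * (ENNReal.ofReal C * (ENNReal.ofReal (V y + b / (1 - a)) + 1)) := by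
  have := hP.isProbabilityMeasure
  have hW := measurable_geomInv_hitTime s hA
  have hWn : ∀ n : ℕ, Measurable fun ω => geomInv s (hitTime A (pathShift n ω)) := fun n =>
    hW.comp (measurable_pathShift n)
  have hmeas : ∀ n : ℕ, Measurable fun ω =>
      ENNReal.ofReal t ^ n * geomInv s (hitTime A (pathShift n ω)) := fun n =>
    (hWn n).const_mul _
  have hVm : ∀ n, Measurable fun ω : ℕ → Y => ENNReal.ofReal (V (ω n)) := fun n =>
    (hV.comp (measurable_pi_apply n)).ennreal_ofReal
  have hbound : ∀ n : ℕ, ∫⁻ ω, geomInv s (hitTime A (pathShift n ω)) ∂P y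
      ≤ ENNReal.ofReal C * (ENNReal.ofReal (V y + b / (1 - a)) + 1) := fun n => by
    calc ∫⁻ ω, geomInv s (hitTime A (pathShift n ω)) ∂P y
        = ∫⁻ ω, ∫⁻ ω', geomInv s (hitTime A ω') ∂P (ω n) ∂P y :=
          hP.lintegral_comp_pathShift hW n y
      _ ≤ ∫⁻ ω, ENNReal.ofReal C * (ENNReal.ofReal (V (ω n)) + 1) ∂P y := by
          refine lintegral_mono fun ω => (hρ (ω n)).trans_eq ?_
          rw [ENNReal.ofReal_mul hC, ENNReal.ofReal_add (hV0 _) zero_le_one, ENNReal.ofReal_one]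
      _ = ENNReal.ofReal C * (∫⁻ ω, ENNReal.ofReal (V (ω n)) ∂P y + 1) := by
          have hVm1 : Measurable fun ω : ℕ → Y => ENNReal.ofReal (V (ω n)) + 1 :=
            (hVm n).add measurable_const
          rw [lintegral_const_mul _ hVm1, lintegral_add_right _ measurable_const]
          simp
      _ ≤ _ := by
          gcongr
          exact hP.lintegral_lyapunov_le hV hV0 ha hb hLyap n y
  calc ∫⁻ ω, excursionWeight t S A ω ∂P y
      ≤ ∫⁻ ω, ((if hitTime S ω = ⊤ then 0 else geomInv r (hitTime S ω))
        + ∑' n : ℕ, ENNReal.ofReal t ^ n * geomInv s (hitTime A (pathShift n ω))) ∂P y := by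
        refine lintegral_mono fun ω => ?_
        by_cases h : hitTime S ω = ⊤
        · simp [excursionWeight_of_eq_top h]
        · obtain ⟨n, hn⟩ := ENat.ne_top_iff_exists.mp h
          rw [excursionWeight, tsum_hitTime_eq (F := fun ω => geomInv t (hitTime A ω)) hn.symm,
            if_neg h, ← hn]
          refine (pow_mul_geomInv_le hr hs ht hrt hst n _).trans ?_
          gcongr
          exact ENNReal.le_tsum (f := fun n =>
            ENNReal.ofReal t ^ n * geomInv s (hitTime A (pathShift n ω))) n
    _ = ∫⁻ ω, (if hitTime S ω = ⊤ then 0 else geomInv r (hitTime S ω)) ∂P y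
        + ∑' n : ℕ, ENNReal.ofReal t ^ n
          * ∫⁻ ω, geomInv s (hitTime A (pathShift n ω)) ∂P y := by
        rw [lintegral_add_right _ (Measurable.tsum hmeas),
          lintegral_tsum fun n => (hmeas n).aemeasurable]
        congr 1
        exact tsum_congr fun n => lintegral_const_mul _ (hWn n)
    _ ≤ _ := by
        rw [← ENNReal.tsum_geometric, ← ENNReal.tsum_mul_right]
        gcongr with n
        exact hbound n

end IsPathFamily

theorem return_time_exponential_moment
    {Y : Type*} [MetricSpace Y] [MeasurableSpace Y] [BorelSpace Y]
    -- the common transition probability function of the chains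
    (π : Kernel Y Y) [IsMarkovKernel π]
    -- the pathspace measures ℙ_y of the chains started at y
    (Ppath : Y → Measure (ℕ → Y)) (hmeas : Measurable Ppath)
    (hprob : ∀ y, IsProbabilityMeasure (Ppath y))
    (hrec : ∀ y, Ppath y = ((π y).bind Ppath).map (prepend y))
    -- V is a Lyapunov function for {π_y}, bounded on bounded sets
    (V : Y → ℝ) (hVmeas : Measurable V) (hVnonneg : ∀ y, 0 ≤ V y)
    (hVbddOnBdd : ∀ s : Set Y, Bornology.IsBounded s → BddAbove (V '' s))
    (a b : ℝ) (ha : a ∈ Set.Ioo (0:ℝ) 1) (hb : 0 < b)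
    (hLyap : ∀ y, ∫⁻ x, ENNReal.ofReal (V x) ∂π y ≤ ENNReal.ofReal (a * V y + b))
    -- A bounded measurable, with E_y λ^{-ρ} ≤ C_ρ (V(y)+1) for ρ = inf{n ≥ 1 : y_n ∈ A}
    (A : Set Y) (hAbdd : Bornology.IsBounded A) (hAmeas : MeasurableSet A)
    (lam Cρ : ℝ) (hlam : lam ∈ Set.Ioo (0:ℝ) 1) (hCρ : 0 < Cρ)
    (hρ : ∀ y, ∫⁻ ω, geomInv lam (⨅ n ∈ {n : ℕ | 1 ≤ n ∧ ω n ∈ A}, (n : ℕ∞)) ∂Ppath y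
      ≤ ENNReal.ofReal (Cρ * (V y + 1)))
    -- B measurable with, for y ∈ A, ℙ_y(∀ n ≥ 1, y_n ∈ B) > p and
    -- E_y 1_{ε<∞} β^{-ε} ≤ C_ε for ε = inf{n ≥ 1 : y_n ∉ B}
    (B : Set Y) (hBmeas : MeasurableSet B)
    (p β Cε : ℝ) (hp : 0 < p) (hβ : β ∈ Set.Ioo (0:ℝ) 1) (hCε : 0 < Cε)
    (hstay : ∀ y ∈ A, ENNReal.ofReal p < Ppath y {ω | ∀ n : ℕ, 1 ≤ n → ω n ∈ B})
    (hε : ∀ y ∈ A, ∫⁻ ω,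
        (if (⨅ n ∈ {n : ℕ | 1 ≤ n ∧ ω n ∉ B}, (n : ℕ∞)) = ⊤ then 0
          else geomInv β (⨅ n ∈ {n : ℕ | 1 ≤ n ∧ ω n ∉ B}, (n : ℕ∞))) ∂Ppath y
      ≤ ENNReal.ofReal Cε) :
    -- conclusion: E_y γ^{-τ} ≤ C (V(y)+1) for τ = inf{n ≥ 1 : ∀ k ≥ n, y_k ∈ B}
    ∃ γ C : ℝ, γ ∈ Set.Ioo (0:ℝ) 1 ∧ 0 < C ∧
      ∀ y, ∫⁻ ω, geomInv γ
          (⨅ n ∈ {n : ℕ | 1 ≤ n ∧ ∀ k : ℕ, n ≤ k → ω k ∈ B}, (n : ℕ∞)) ∂Ppath y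
        ≤ ENNReal.ofReal (C * (V y + 1)) := by
  have hP : IsPathFamily π Ppath := ⟨hmeas, hprob, hrec⟩
  have hρ' : ∀ y, ∫⁻ ω, geomInv lam (hitTime A ω) ∂Ppath y ≤ ENNReal.ofReal (Cρ * (V y + 1)) := hρ
  have hε' : ∀ y ∈ A, ∫⁻ ω, (if hitTime Bᶜ ω = ⊤ then 0 else geomInv β (hitTime Bᶜ ω)) ∂Ppath y
      ≤ ENNReal.ofReal Cε := hε
  obtain ⟨t, ht, hβt, hlamt⟩ : ∃ t ∈ Ioo (0 : ℝ) 1, β ≤ t ^ 4 ∧ lam ≤ t ^ 4 := by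
    have hs0 : 0 < max β lam := lt_max_of_lt_left hβ.1
    refine ⟨√√(max β lam), ⟨by positivity, ?_⟩, ?_⟩
    · rw [Real.sqrt_lt' one_pos, Real.sqrt_lt' (by positivity)]
      simpa using ⟨hβ.2, hlam.2⟩
    · rw [show √√(max β lam) ^ 4 = (√√(max β lam) ^ 2) ^ 2 by ring, Real.sq_sqrt (by positivity),
        Real.sq_sqrt hs0.le]
      exact ⟨le_max_left _ _, le_max_right _ _⟩
  obtain ⟨D, hD0, hD⟩ : ∃ D : ℝ, 0 ≤ D ∧
      ∀ y ∈ A, ∫⁻ ω, excursionWeight t Bᶜ A ω ∂Ppath y ≤ ENNReal.ofReal D := by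
    obtain ⟨M, hM⟩ := hVbddOnBdd A hAbdd
    set K : ℝ≥0∞ := ENNReal.ofReal Cε + (1 - ENNReal.ofReal t)⁻¹
      * (ENNReal.ofReal Cρ * (ENNReal.ofReal (M + b / (1 - a)) + 1)) with hK
    have hKfin : K ≠ ⊤ := by
      have h1 : 1 - ENNReal.ofReal t ≠ 0 :=
        (tsub_pos_iff_lt.mpr (ENNReal.ofReal_lt_one.mpr ht.2)).ne'
      finiteness
    refine ⟨K.toReal, ENNReal.toReal_nonneg, fun y hy => ?_⟩
    rw [ENNReal.ofReal_toReal hKfin, hK]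
    refine (hP.lintegral_excursionWeight_le hβ.1 hlam.1 ht hβt hlamt hAmeas hVmeas hVnonneg ha
      hb.le hLyap hCρ.le hρ' y).trans ?_
    gcongr
    · exact hε' y hy
    · exact hM (mem_image_of_mem V hy)
  obtain ⟨q, hq, hqp⟩ : ∃ q : ℝ, q ∈ Ioo (0 : ℝ) 1 ∧ q ≤ p :=
    ⟨min p (1 / 2), ⟨lt_min hp (by norm_num), (min_le_right _ _).trans_lt (by norm_num)⟩,
      min_le_left _ _⟩
  obtain ⟨θ, hθ, hθD⟩ : ∃ θ ∈ Ioo (0 : ℝ) 1, θ * D ≤ q / 2 := by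
    refine ⟨q / (2 * (D + 1)), ⟨by have := hq.1; positivity, ?_⟩, ?_⟩
    · rw [div_lt_one (by positivity)]; linarith [hq.2]
    · rw [div_mul_eq_mul_div, div_le_div_iff₀ (by positivity) (by positivity)]
      nlinarith [hq.1]
  have ht1 : 1 < t⁻¹ := (one_lt_inv₀ ht.1).mpr ht.2
  obtain ⟨γ, hγ, hγθ, htγ⟩ : ∃ γ ∈ Ioo (0 : ℝ) 1, γ⁻¹ = 1 - θ + θ * t⁻¹ ∧ t ≤ γ := by
    have h1 : 1 < 1 - θ + θ * t⁻¹ := by nlinarith [hθ.1]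
    refine ⟨(1 - θ + θ * t⁻¹)⁻¹, ⟨by positivity, inv_lt_one_of_one_lt₀ h1⟩, inv_inv _, ?_⟩
    rw [le_inv_comm₀ ht.1 (by positivity)]
    nlinarith [hθ.2]
  have hW : ∀ y, ∫⁻ ω, geomInv γ (hitTime A ω) ∂Ppath y ≤ ENNReal.ofReal (Cρ * (V y + 1)) :=
    fun y => (lintegral_mono fun ω => geomInv_anti hlam.1
      (hlamt.trans ((pow_le_of_le_one ht.1.le ht.2.le (by norm_num)).trans htγ)) _).trans (hρ' y)
  have hWfin : ∀ y, ∫⁻ ω, geomInv γ (hitTime A ω) ∂Ppath y ≠ ⊤ := fun y =>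
    ((hW y).trans_lt ENNReal.ofReal_lt_top).ne
  have hexc : ∀ y ∈ A, ∫⁻ ω, excursionWeight γ Bᶜ A ω ∂Ppath y ≤ ENNReal.ofReal (1 - q / 2) := by
    intro y hy
    have hleave : Ppath y {ω | hitTime Bᶜ ω ≠ ⊤} ≤ ENNReal.ofReal (1 - q) := by
      have := hprob y
      have hset : {ω : ℕ → Y | hitTime Bᶜ ω ≠ ⊤} = {ω | ∀ n : ℕ, 1 ≤ n → ω n ∈ B}ᶜ := by
        ext ω
        simp [hitTime_eq_top_iff]
      have hm : MeasurableSet {ω : ℕ → Y | hitTime Bᶜ ω ≠ ⊤} :=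
        (measurable_hitTime hBmeas.compl (measurableSet_singleton ⊤)).compl
      rw [hset] at hm ⊢
      rw [prob_compl_eq_one_sub (MeasurableSet.compl_iff.mp hm), ENNReal.ofReal_sub _ hq.1.le,
        ENNReal.ofReal_one]
      exact tsub_le_tsub_left ((ENNReal.ofReal_le_ofReal hqp).trans (hstay y hy).le) 1
    calc ∫⁻ ω, excursionWeight γ Bᶜ A ω ∂Ppath y
        ≤ ENNReal.ofReal (1 - θ) * Ppath y {ω | hitTime Bᶜ ω ≠ ⊤}
          + ENNReal.ofReal θ * ∫⁻ ω, excursionWeight t Bᶜ A ω ∂Ppath y :=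
          lintegral_excursionWeight_le_interpolate _ ht.1 hγ.1 hθ hγθ hAmeas hBmeas.compl
      _ ≤ ENNReal.ofReal (1 - θ) * ENNReal.ofReal (1 - q)
          + ENNReal.ofReal θ * ENNReal.ofReal D := by
          gcongr
          exact hD y hy
      _ = ENNReal.ofReal ((1 - θ) * (1 - q) + θ * D) := by
          have h1 : 0 ≤ 1 - θ := sub_nonneg.mpr hθ.2.le
          have h2 : 0 ≤ 1 - q := sub_nonneg.mpr hq.2.le
          rw [← ENNReal.ofReal_mul h1, ← ENNReal.ofReal_mul hθ.1.le,
            ← ENNReal.ofReal_add (mul_nonneg h1 h2) (mul_nonneg hθ.1.le hD0)]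
      _ ≤ ENNReal.ofReal (1 - q / 2) := by
          apply ENNReal.ofReal_le_ofReal
          nlinarith [hθ.1, hθ.2, hq.1, hq.2]
  have hτ : Measurable fun ω : ℕ → Y => geomInv γ (settleTime B ω) :=
    (Measurable.of_discrete (f := geomInv γ)).comp (measurable_settleTime hBmeas)
  have hγ0 : 0 < γ⁻¹ := inv_pos.mpr hγ.1
  have hK0 : 0 < 2 * γ⁻¹ / q := div_pos (by positivity) hq.1
  have htrunc : ∀ (N : ℕ) (y : Y), ∫⁻ ω, min (geomInv γ (settleTime B ω)) N ∂Ppath y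
      ≤ ENNReal.ofReal (Cρ * (V y + 1)) * ENNReal.ofReal (2 * γ⁻¹ / q) := by
    intro N y
    have hG : Measurable fun ω : ℕ → Y => min (geomInv γ (settleTime B ω)) (N : ℝ≥0∞) :=
      hτ.min measurable_const
    have hshift : ∀ (m : ℕ) (ω : ℕ → Y), min (geomInv γ (settleTime B ω)) (N : ℝ≥0∞)
        ≤ ENNReal.ofReal γ⁻¹ ^ m * min (geomInv γ (settleTime B (pathShift m ω))) N := by
      intro m ω
      rw [mul_min]
      refine min_le_min ?_ (le_mul_of_one_le_left' (one_le_pow₀ (one_le_ofReal_inv hγ)))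
      rw [← geomInv_natCast_add hγ.1]
      exact geomInv_mono hγ (settleTime_le_add B ω m)
    have hstay' : ∀ ω : ℕ → Y, hitTime Bᶜ ω = ⊤ →
        min (geomInv γ (settleTime B ω)) (N : ℝ≥0∞) ≤ ENNReal.ofReal γ⁻¹ := by
      intro ω hω
      refine (min_le_left _ _).trans ?_
      have h1 : settleTime B ω ≤ (1 : ℕ) := by
        simpa using settleTime_le_one fun n hn => not_notMem.mp (hitTime_eq_top_iff.mp hω n hn)
      exact (geomInv_mono hγ h1).trans_eq (by rw [geomInv_natCast hγ.1, pow_one])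
    set U : ℝ≥0∞ := ⨆ x ∈ A, ∫⁻ ω, min (geomInv γ (settleTime B ω)) (N : ℝ≥0∞) ∂Ppath x
    have hUle : ∀ x ∈ A, ∫⁻ ω, min (geomInv γ (settleTime B ω)) (N : ℝ≥0∞) ∂Ppath x ≤ U :=
      fun x hx => le_iSup₂ (f := fun x (_ : x ∈ A) =>
        ∫⁻ ω, min (geomInv γ (settleTime B ω)) (N : ℝ≥0∞) ∂Ppath x) x hx
    have hUfin : U ≠ ⊤ := by
      refine ((iSup₂_le fun x _ => ?_ : U ≤ N).trans_lt (ENNReal.natCast_lt_top N)).ne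
      have := hprob x
      calc _ ≤ ∫⁻ _, (N : ℝ≥0∞) ∂Ppath x := lintegral_mono fun ω => min_le_right _ _
        _ = N := by simp
    have hrenew : U ≤ ENNReal.ofReal γ⁻¹ + ENNReal.ofReal (1 - q / 2) * U := by
      refine iSup₂_le fun x hx => ?_
      refine (hP.lintegral_le_add_excursionWeight_mul hγ hAmeas hBmeas.compl hG hshift hstay'
        hWfin hUle x).trans ?_
      gcongr
      exact hexc x hx
    have hUK : U ≤ ENNReal.ofReal (2 * γ⁻¹ / q) := by
      lift U to ℝ≥0 using hUfin with u
      have hq2 : 0 ≤ 1 - q / 2 := by linarith [hq.2]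
      rw [← ENNReal.ofReal_coe_nnreal, ← ENNReal.ofReal_mul hq2,
        ← ENNReal.ofReal_add hγ0.le (by positivity),
        ENNReal.ofReal_le_ofReal_iff (by positivity)] at hrenew
      rw [← ENNReal.ofReal_coe_nnreal]
      apply ENNReal.ofReal_le_ofReal
      rw [le_div_iff₀ hq.1]
      linarith
    calc _ ≤ (∫⁻ ω, geomInv γ (hitTime A ω) ∂Ppath y) * U :=
          hP.lintegral_le_geomInv_hitTime_mul hγ hAmeas hG hshift hUle y (hWfin y)
      _ ≤ _ := by gcongr; exact hW y
  refine ⟨γ, Cρ * (2 * γ⁻¹ / q), hγ, mul_pos hCρ hK0, fun y => ?_⟩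
  have hsup : ∀ x : ℝ≥0∞, x = ⨆ N : ℕ, min x (N : ℝ≥0∞) := fun x => by
    rw [← inf_iSup_eq, ENNReal.iSup_natCast, inf_top_eq]
  calc ∫⁻ ω, geomInv γ (settleTime B ω) ∂Ppath y
      = ∫⁻ ω, ⨆ N : ℕ, min (geomInv γ (settleTime B ω)) (N : ℝ≥0∞) ∂Ppath y :=
        lintegral_congr fun ω => hsup _
    _ = ⨆ N : ℕ, ∫⁻ ω, min (geomInv γ (settleTime B ω)) (N : ℝ≥0∞) ∂Ppath y :=
        lintegral_iSup (fun N => hτ.min measurable_const)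
          fun M N hMN ω => min_le_min_left _ (Nat.cast_le.mpr hMN)
    _ ≤ ENNReal.ofReal (Cρ * (V y + 1)) * ENNReal.ofReal (2 * γ⁻¹ / q) :=
        iSup_le fun N => htrunc N y
    _ = ENNReal.ofReal (Cρ * (2 * γ⁻¹ / q) * (V y + 1)) := by
        rw [← ENNReal.ofReal_mul (mul_nonneg hCρ.le (add_nonneg (hVnonneg y) zero_le_one))]
        congr 1
        ring

end
end

section
/- Assume B1–B4. Then the Markov operator Pf(x) = ∫_Θ f(S_θ(x)) ϑ_x(dθ) possesses a unique invariant probability measure μ* with ∫_X d(x̄,x) μ*(dx) < ∞, this measure is attractive among all Borel probability measures on X, and there exist q ∈ (0,1) and C > 0 such that ‖P^{*n}μ − μ*‖_FM ≤ q^n C (1 + ∫_X d(x̄,x) μ(dx)) for every probability measure μ with ∫ d(x̄,x) μ(dx) < ∞ and every n ∈ ℕ. -/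
open MeasureTheory ProbabilityTheory Filter Set
open scoped ENNReal NNReal

noncomputable section

/-- The Fortet–Mourier distance between two Borel measures. -/
def fmDist {X : Type*} [MetricSpace X] [MeasurableSpace X] (μ ν : Measure X) : ℝ :=
  sSup {r : ℝ | ∃ f : X → ℝ, Continuous f ∧ (∀ x, |f x| ≤ 1) ∧
    (∀ x y, |f x - f y| ≤ dist x y) ∧ r = |∫ x, f x ∂μ - ∫ x, f x ∂ν|}

/-- The total variation norm `‖μ - ν‖` of the difference of two finite measures:
`|μ - ν|(univ) = sup_A ((μ A - ν A) - (μ Aᶜ - ν Aᶜ))`. -/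
def tvNorm {Θ : Type*} [MeasurableSpace Θ] (μ ν : Measure Θ) : ℝ :=
  sSup {r : ℝ | ∃ A : Set Θ, MeasurableSet A ∧
    r = ((μ A).toReal - (ν A).toReal) - ((μ Aᶜ).toReal - (ν Aᶜ).toReal)}

/-- The bounded Lipschitz functions over which the Fortet–Mourier norm is a supremum. -/
structure IsFMTest {X : Type*} [MetricSpace X] (f : X → ℝ) : Prop where
  continuous : Continuous f
  abs_le_one : ∀ x, |f x| ≤ 1
  abs_sub_le : ∀ x y, |f x - f y| ≤ dist x y

section Weak

variable {X : Type*} [MetricSpace X] [MeasurableSpace X] [BorelSpace X]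

theorem integrable_of_abs_le {Y : Type*} [MeasurableSpace Y] {μ : Measure Y} [IsFiniteMeasure μ]
    {f : Y → ℝ} (hf : Measurable f) {M : ℝ} (hM : ∀ x, |f x| ≤ M) : Integrable f μ :=
  Integrable.of_bound hf.aestronglyMeasurable M (ae_of_all _ hM)

theorem IsFMTest.integrable {f : X → ℝ} (hf : IsFMTest f) (μ : Measure X) [IsFiniteMeasure μ] :
    Integrable f μ :=
  integrable_of_abs_le hf.continuous.measurable hf.abs_le_one

theorem ProbabilityMeasure.tendsto_of_forall_isFMTest {γ : Type*} {F : Filter γ}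
    [F.IsCountablyGenerated] {μs : γ → ProbabilityMeasure X} {μ : ProbabilityMeasure X}
    (h : ∀ f : X → ℝ, IsFMTest f →
      Tendsto (fun i => ∫ x, f x ∂(μs i : Measure X)) F (nhds (∫ x, f x ∂(μ : Measure X)))) :
    Tendsto μs F (nhds μ) := by
  rw [tendsto_iff_forall_lipschitz_integral_tendsto]
  rintro f ⟨C, hC⟩ ⟨L, hL⟩
  obtain ⟨x₀⟩ : Nonempty X := nonempty_of_isProbabilityMeasure (μ : Measure X)
  set D : ℝ := 1 + L + |f x₀| + |C| with hD
  have hDpos : 0 < D := by positivity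
  have htest : IsFMTest (fun x => f x / D) := by
    refine ⟨hL.continuous.div_const _, fun x => ?_, fun x y => ?_⟩
    · rw [abs_div, abs_of_pos hDpos, div_le_one hDpos]
      have h1 := hC x x₀
      rw [Real.dist_eq] at h1
      have h2 := abs_sub_abs_le_abs_sub (f x) (f x₀)
      have h3 := le_abs_self C
      have := L.coe_nonneg
      linarith
    · rw [← sub_div, abs_div, abs_of_pos hDpos, div_le_iff₀ hDpos]
      have h1 := hL.dist_le_mul x y
      rw [Real.dist_eq] at h1
      have : (L : ℝ) ≤ D := by rw [hD]; linarith [abs_nonneg (f x₀), abs_nonneg C]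
      nlinarith [dist_nonneg (x := x) (y := y)]
  have := (h _ htest).mul_const D
  simpa [integral_div, hDpos.ne'] using this

theorem Measure.eq_of_forall_isFMTest {μ ν : Measure X} [IsProbabilityMeasure μ]
    [IsProbabilityMeasure ν]
    (h : ∀ f : X → ℝ, IsFMTest f → ∫ x, f x ∂μ = ∫ x, f x ∂ν) : μ = ν := by
  let μ' : ProbabilityMeasure X := ⟨μ, inferInstance⟩
  let ν' : ProbabilityMeasure X := ⟨ν, inferInstance⟩
  have h1 : Tendsto (fun _ : ℕ => μ') atTop (nhds ν') := by
    refine ProbabilityMeasure.tendsto_of_forall_isFMTest fun f hf => ?_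
    change Tendsto (fun _ : ℕ => ∫ x, f x ∂μ) atTop (nhds (∫ x, f x ∂ν))
    rw [h f hf]
    exact tendsto_const_nhds
  exact congrArg ProbabilityMeasure.toMeasure (tendsto_nhds_unique tendsto_const_nhds h1)

omit [MeasurableSpace X] [BorelSpace X] in
theorem isFMTest_min_infDist (F : Set X) :
    IsFMTest (fun x => min 1 (Metric.infDist x F)) := by
  refine ⟨by fun_prop, fun x => ?_, fun x y => ?_⟩
  · rw [abs_of_nonneg (le_min zero_le_one Metric.infDist_nonneg)]
    exact min_le_left _ _
  · refine (abs_min_sub_min_le_max _ _ _ _).trans ?_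
    rw [sub_self, abs_zero]
    refine max_le dist_nonneg ?_
    have := (Metric.lipschitz_infDist_pt F).dist_le_mul x y
    simpa [Real.dist_eq] using this

omit [MeasurableSpace X] [BorelSpace X] in
theorem tendsto_min_infDist {D : ℕ → X} (hD : DenseRange D) (x : X) :
    Tendsto (fun k => min 1 (Metric.infDist x (D '' Set.Iic k))) atTop (nhds 0) := by
  rw [Metric.tendsto_atTop]
  intro ε hε
  obtain ⟨i, hi⟩ := hD.exists_dist_lt x hε
  refine ⟨i, fun k hk => ?_⟩
  have h0 : 0 ≤ min 1 (Metric.infDist x (D '' Set.Iic k)) :=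
    le_min zero_le_one Metric.infDist_nonneg
  have hmem : D i ∈ D '' Set.Iic k := ⟨i, hk, rfl⟩
  rw [Real.dist_eq, sub_zero, abs_of_nonneg h0]
  exact (min_le_right _ _).trans_lt ((Metric.infDist_le_dist_of_mem hmem).trans_lt hi)

theorem tendsto_integral_min_infDist {D : ℕ → X} (hD : DenseRange D) (μ : Measure X)
    [IsProbabilityMeasure μ] :
    Tendsto (fun k => ∫ x, min 1 (Metric.infDist x (D '' Set.Iic k)) ∂μ) atTop (nhds 0) := by
  have h := tendsto_integral_of_dominated_convergence (μ := μ) (f := fun _ => (0 : ℝ))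
    (F := fun k x => min 1 (Metric.infDist x (D '' Set.Iic k))) (fun _ => (1 : ℝ))
    (fun k => (isFMTest_min_infDist (D '' Set.Iic k)).continuous.measurable.aestronglyMeasurable)
    (integrable_const _)
    (fun k => ae_of_all _ (isFMTest_min_infDist (D '' Set.Iic k)).abs_le_one)
    (ae_of_all _ (tendsto_min_infDist hD))
  rwa [integral_zero] at h

theorem exists_forall_measure_infDist_le {D : ℕ → X} (hD : DenseRange D)
    {μ : ℕ → Measure X} [∀ n, IsProbabilityMeasure (μ n)] {b : ℕ → ℝ}
    (hb : Tendsto b atTop (nhds 0))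
    (hμ : ∀ f : X → ℝ, IsFMTest f → ∀ N n, N ≤ n → |∫ x, f x ∂μ n - ∫ x, f x ∂μ N| ≤ b N)
    {r ε : ℝ} (hr : 0 < r) (hr1 : r ≤ 1) (hε : 0 < ε) :
    ∃ k, ∀ n, μ n {x | r ≤ Metric.infDist x (D '' Set.Iic k)} ≤ ENNReal.ofReal ε := by
  have hpos : 0 < ε * r / 2 := by positivity
  obtain ⟨N, hN⟩ := (hb.eventually_lt_const hpos).exists
  have hev : ∀ᶠ k in atTop, ∀ n ∈ Set.Iic N,
      ∫ x, min 1 (Metric.infDist x (D '' Set.Iic k)) ∂μ n < ε * r / 2 :=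
    (eventually_all_finite (Set.finite_Iic N)).2 fun n _ =>
      (tendsto_integral_min_infDist hD (μ n)).eventually_lt_const hpos
  obtain ⟨k, hk⟩ := hev.exists
  refine ⟨k, fun n => ?_⟩
  have htest := isFMTest_min_infDist (D '' Set.Iic k)
  have hint : ∫ x, min 1 (Metric.infDist x (D '' Set.Iic k)) ∂μ n ≤ ε * r := by
    rcases le_total n N with h | h
    · exact (hk n h).le.trans (by linarith)
    · have h1 := (abs_le.1 (hμ _ htest N n h)).2
      have h2 := hk N (Set.mem_Iic.2 le_rfl)
      linarith
  have hmarkov := mul_meas_ge_le_integral_of_nonneg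
    (ae_of_all (μ n) fun x => le_min zero_le_one (Metric.infDist_nonneg (x := x)
      (s := D '' Set.Iic k))) (htest.integrable (μ n)) r
  have hset : {x | r ≤ min 1 (Metric.infDist x (D '' Set.Iic k))}
      = {x | r ≤ Metric.infDist x (D '' Set.Iic k)} := by
    ext x; simp [hr1]
  rw [hset] at hmarkov
  rw [← ENNReal.ofReal_toReal (measure_ne_top (μ n) _)]
  refine ENNReal.ofReal_le_ofReal ?_
  rw [measureReal_def] at hmarkov
  nlinarith

theorem isTightMeasureSet_range_of_fm_cauchy [CompleteSpace X] [SecondCountableTopology X]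
    {μ : ℕ → Measure X} [∀ n, IsProbabilityMeasure (μ n)] {b : ℕ → ℝ}
    (hb : Tendsto b atTop (nhds 0))
    (hμ : ∀ f : X → ℝ, IsFMTest f → ∀ N n, N ≤ n → |∫ x, f x ∂μ n - ∫ x, f x ∂μ N| ≤ b N) :
    IsTightMeasureSet (Set.range μ) := by
  have : Nonempty X := nonempty_of_isProbabilityMeasure (μ 0)
  obtain ⟨D, hD⟩ := TopologicalSpace.exists_dense_seq X
  rw [isTightMeasureSet_iff_exists_isCompact_measure_compl_le]
  intro ε hε
  obtain ⟨u, hu_pos, hu_sum⟩ := ENNReal.exists_pos_sum_of_countable hε.ne' ℕ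
  have hr (j : ℕ) : (0 : ℝ) < 1 / (j + 1) := by positivity
  have hr1 (j : ℕ) : (1 : ℝ) / (j + 1) ≤ 1 := by
    rw [div_le_one (by positivity)]; linarith [(Nat.cast_nonneg j : (0 : ℝ) ≤ j)]
  choose k hk using fun j : ℕ =>
    exists_forall_measure_infDist_le hD hb hμ (hr j) (hr1 j) (NNReal.coe_pos.2 (hu_pos j))
  refine ⟨⋂ j : ℕ, {x | Metric.infDist x (D '' Set.Iic (k j)) ≤ 1 / (j + 1)}, ?_, ?_⟩
  · refine TotallyBounded.isCompact_of_isClosed ?_ ?_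
    · rw [Metric.totallyBounded_iff]
      intro e he
      obtain ⟨j, hj⟩ := exists_nat_one_div_lt he
      refine ⟨D '' Set.Iic (k j), (Set.finite_Iic _).image D, fun x hx => ?_⟩
      have hx' : Metric.infDist x (D '' Set.Iic (k j)) < e :=
        lt_of_le_of_lt (mem_iInter.1 hx j) hj
      obtain ⟨y, hy, hxy⟩ :=
        (Metric.infDist_lt_iff ((Set.nonempty_Iic).image D)).1 hx'
      exact mem_iUnion₂.2 ⟨y, hy, hxy⟩
    · exact isClosed_iInter fun j => isClosed_le (Metric.continuous_infDist_pt _) continuous_const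
  · rintro _ ⟨n, rfl⟩
    rw [compl_iInter]
    refine (measure_iUnion_le _).trans (le_trans (ENNReal.tsum_le_tsum fun j => ?_) hu_sum.le)
    refine le_trans (measure_mono fun x hx => ?_) ((hk j n).trans ?_)
    · exact (lt_of_not_ge (show ¬ Metric.infDist x _ ≤ _ from hx)).le
    · simp

/-- A sequence of probability measures on a Polish space that is Cauchy for the Fortet–Mourier
norm converges weakly. -/
theorem exists_tendsto_of_fm_cauchy [CompleteSpace X] [SecondCountableTopology X]
    {μ : ℕ → ProbabilityMeasure X} {b : ℕ → ℝ} (hb : Tendsto b atTop (nhds 0))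
    (hμ : ∀ f : X → ℝ, IsFMTest f → ∀ N n, N ≤ n →
      |∫ x, f x ∂(μ n : Measure X) - ∫ x, f x ∂(μ N : Measure X)| ≤ b N) :
    ∃ μstar : ProbabilityMeasure X, Tendsto μ atTop (nhds μstar) := by
  have htight := isTightMeasureSet_range_of_fm_cauchy hb hμ
  have hcomp : IsCompact (closure (Set.range μ)) := by
    refine isCompact_closure_of_isTightMeasureSet (htight.subset ?_)
    rintro _ ⟨_, ⟨n, rfl⟩, rfl⟩
    exact ⟨n, rfl⟩
  obtain ⟨μstar, -, φ, hφ, hlim⟩ :=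
    hcomp.isSeqCompact (fun n => subset_closure (mem_range_self n))
  refine ⟨μstar, ProbabilityMeasure.tendsto_of_forall_isFMTest fun f hf => ?_⟩
  have hcauchy : CauchySeq fun n => ∫ x, f x ∂(μ n : Measure X) := by
    refine cauchySeq_of_le_tendsto_0' b (fun N n h => ?_) hb
    rw [dist_comm, Real.dist_eq]
    exact hμ f hf N n h
  refine tendsto_nhds_of_cauchySeq_of_subseq hcauchy hφ.tendsto_atTop ?_
  have := (ProbabilityMeasure.tendsto_iff_forall_integral_tendsto.1 hlim)
    (BoundedContinuousFunction.ofNormedAddCommGroup f hf.continuous 1 hf.abs_le_one)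
  exact this

end Weak

section MarkovOperator

variable {X : Type*} [MeasurableSpace X]

/-- The Markov operator of a kernel, acting on functions. -/
def markovOp (κ : Kernel X X) (f : X → ℝ) : X → ℝ := fun x => ∫ y, f y ∂κ x

theorem measurable_markovOp (κ : Kernel X X) [IsMarkovKernel κ] {f : X → ℝ} (hf : Measurable f) :
    Measurable (markovOp κ f) :=
  (hf.stronglyMeasurable.integral_kernel (κ := κ)).measurable

theorem abs_markovOp_le (κ : Kernel X X) [IsMarkovKernel κ] {f : X → ℝ} {M : ℝ}
    (hM : ∀ x, |f x| ≤ M) (x : X) : |markovOp κ f x| ≤ M := by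
  simpa [markovOp] using
    norm_integral_le_of_norm_le_const (μ := κ x) (f := f) (C := M) (ae_of_all _ hM)

theorem measurable_iterate_markovOp (κ : Kernel X X) [IsMarkovKernel κ] {f : X → ℝ}
    (hf : Measurable f) (n : ℕ) : Measurable ((markovOp κ)^[n] f) := by
  induction n with
  | zero => exact hf
  | succ n ih => rw [Function.iterate_succ_apply']; exact measurable_markovOp κ ih

theorem abs_iterate_markovOp_le (κ : Kernel X X) [IsMarkovKernel κ] {f : X → ℝ} {M : ℝ}
    (hM : ∀ x, |f x| ≤ M) (n : ℕ) (x : X) : |(markovOp κ)^[n] f x| ≤ M := by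
  induction n generalizing x with
  | zero => exact hM x
  | succ n ih => rw [Function.iterate_succ_apply']; exact abs_markovOp_le κ ih x

instance isProbabilityMeasure_iterate_bind (κ : Kernel X X) [IsMarkovKernel κ] (μ : Measure X)
    [IsProbabilityMeasure μ] (n : ℕ) :
    IsProbabilityMeasure ((fun m : Measure X => m.bind κ)^[n] μ) := by
  induction n with
  | zero => assumption
  | succ n ih => rw [Function.iterate_succ_apply']; infer_instance

theorem integral_bind_eq_integral_markovOp (κ : Kernel X X) [IsMarkovKernel κ] (μ : Measure X)
    [IsProbabilityMeasure μ] {f : X → ℝ} (hf : Measurable f) {M : ℝ} (hM : ∀ x, |f x| ≤ M) :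
    ∫ x, f x ∂μ.bind κ = ∫ x, markovOp κ f x ∂μ := by
  rw [Measure.comp_eq_comp_const_apply,
    Kernel.integral_comp (integrable_of_abs_le hf hM), Kernel.const_apply]
  rfl

theorem integral_iterate_bind (κ : Kernel X X) [IsMarkovKernel κ] (μ : Measure X)
    [IsProbabilityMeasure μ] {f : X → ℝ} (hf : Measurable f) {M : ℝ} (hM : ∀ x, |f x| ≤ M)
    (n : ℕ) :
    ∫ x, f x ∂((fun m : Measure X => m.bind κ)^[n] μ) = ∫ x, (markovOp κ)^[n] f x ∂μ := by
  induction n generalizing f with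
  | zero => rfl
  | succ n ih =>
    rw [Function.iterate_succ_apply', integral_bind_eq_integral_markovOp κ _ hf hM,
      ih (measurable_markovOp κ hf) (abs_markovOp_le κ hM), Function.iterate_succ_apply]

end MarkovOperator

section Ergodic

variable {X : Type*} [MetricSpace X] [MeasurableSpace X] [BorelSpace X]

theorem integrable_dist_of_lintegral_lt_top (xbar : X) {μ : Measure X}
    (hμ : ∫⁻ x, ENNReal.ofReal (dist xbar x) ∂μ < ⊤) : Integrable (fun x => dist xbar x) μ :=
  ⟨(by fun_prop : Continuous fun x => dist xbar x).measurable.aestronglyMeasurable,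
    (hasFiniteIntegral_iff_ofReal (ae_of_all _ fun _ => dist_nonneg)).2 hμ⟩

omit [BorelSpace X] in
theorem fmDist_le {μ ν : Measure X} {a : ℝ}
    (h : ∀ f, IsFMTest f → |∫ x, f x ∂μ - ∫ x, f x ∂ν| ≤ a) : fmDist μ ν ≤ a := by
  refine csSup_le ⟨_, fun _ => 0, continuous_const, by simp, by simp, rfl⟩ ?_
  rintro _ ⟨f, h1, h2, h3, rfl⟩
  exact h f ⟨h1, h2, h3⟩

theorem lintegral_dist_le_of_tendsto {xbar : X} {μ : ℕ → ProbabilityMeasure X}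
    {μstar : ProbabilityMeasure X} (hμ : Tendsto μ atTop (nhds μstar)) {a : ℝ≥0∞}
    (ha : ∀ n, ∫⁻ x, ENNReal.ofReal (dist xbar x) ∂(μ n : Measure X) ≤ a) :
    ∫⁻ x, ENNReal.ofReal (dist xbar x) ∂(μstar : Measure X) ≤ a := by
  have hmono : Monotone fun (k : ℕ) (x : X) => ENNReal.ofReal (min (dist xbar x) k) :=
    fun i j hij x => ENNReal.ofReal_le_ofReal (min_le_min_left _ (Nat.cast_le.2 hij))
  have hsup (x : X) : ENNReal.ofReal (dist xbar x)
      = ⨆ k : ℕ, ENNReal.ofReal (min (dist xbar x) k) := by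
    refine le_antisymm ?_ (iSup_le fun k => ENNReal.ofReal_le_ofReal (min_le_left _ _))
    obtain ⟨k, hk⟩ := exists_nat_ge (dist xbar x)
    exact le_iSup_of_le k (by rw [min_eq_left hk])
  have hcont (k : ℕ) : Continuous fun x : X => min (dist xbar x) (k : ℝ) := by fun_prop
  simp_rw [hsup]
  rw [lintegral_iSup (fun k => (hcont k).measurable.ennreal_ofReal) hmono]
  refine iSup_le fun k => ?_
  have hnn (x : X) : 0 ≤ min (dist xbar x) (k : ℝ) := le_min dist_nonneg k.cast_nonneg
  have hbd (x : X) : |min (dist xbar x) (k : ℝ)| ≤ k := by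
    rw [abs_of_nonneg (hnn x)]; exact min_le_right _ _
  have hlim : Tendsto (fun n => ∫ x, min (dist xbar x) (k : ℝ) ∂(μ n : Measure X)) atTop
      (nhds (∫ x, min (dist xbar x) (k : ℝ) ∂(μstar : Measure X))) :=
    (ProbabilityMeasure.tendsto_iff_forall_integral_tendsto.1 hμ)
      (BoundedContinuousFunction.ofNormedAddCommGroup _ (hcont k) k hbd)
  have heq (ρ : Measure X) [IsProbabilityMeasure ρ] :
      ∫⁻ x, ENNReal.ofReal (min (dist xbar x) k) ∂ρ
        = ENNReal.ofReal (∫ x, min (dist xbar x) (k : ℝ) ∂ρ) :=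
    (ofReal_integral_eq_lintegral_ofReal (integrable_of_abs_le (hcont k).measurable hbd)
      (ae_of_all _ hnn)).symm
  rw [heq]
  refine le_of_tendsto (ENNReal.tendsto_ofReal hlim) (Eventually.of_forall fun n => ?_)
  rw [← heq]
  exact (lintegral_mono fun x => ENNReal.ofReal_le_ofReal (min_le_left _ _)).trans (ha n)

theorem lintegral_dist_iterate_bind_le [SecondCountableTopology X]
    (κ : Kernel X X) [IsMarkovKernel κ] {xbar : X} {α c : ℝ}
    (hα0 : 0 ≤ α) (hα1 : α < 1) (hc : 0 ≤ c)
    (hlyap : ∀ x, ∫⁻ y, ENNReal.ofReal (dist xbar y) ∂κ x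
      ≤ ENNReal.ofReal (α * dist xbar x + c)) (n : ℕ) :
    ∫⁻ x, ENNReal.ofReal (dist xbar x)
      ∂((fun m : Measure X => m.bind κ)^[n] (Measure.dirac xbar))
      ≤ ENNReal.ofReal (c / (1 - α)) := by
  have hM : 0 ≤ c / (1 - α) := div_nonneg hc (by linarith)
  have hmeas : Measurable fun x : X => ENNReal.ofReal (dist xbar x) := by fun_prop
  induction n with
  | zero => simp [lintegral_dirac' _ hmeas]
  | succ n ih =>
    rw [Function.iterate_succ_apply', Measure.lintegral_bind κ.measurable.aemeasurable
      hmeas.aemeasurable]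
    calc _ ≤ ∫⁻ x, (ENNReal.ofReal α * ENNReal.ofReal (dist xbar x) + ENNReal.ofReal c)
            ∂((fun m : Measure X => m.bind κ)^[n] (Measure.dirac xbar)) := by
          refine lintegral_mono fun x => (hlyap x).trans_eq ?_
          rw [ENNReal.ofReal_add (by positivity) hc, ENNReal.ofReal_mul hα0]
      _ ≤ ENNReal.ofReal α * ENNReal.ofReal (c / (1 - α)) + ENNReal.ofReal c := by
          rw [lintegral_add_right _ measurable_const, lintegral_const_mul _ hmeas]
          simp only [lintegral_const, measure_univ, mul_one]
          gcongr
      _ = ENNReal.ofReal (c / (1 - α)) := by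
          rw [← ENNReal.ofReal_mul hα0, ← ENNReal.ofReal_add (by positivity) hc]
          congr 1
          have : 1 - α ≠ 0 := by linarith
          field_simp
          ring

theorem abs_integral_iterate_sub_le (κ : Kernel X X) [IsMarkovKernel κ] {xbar : X} {A q : ℝ}
    (hcontr : ∀ f, IsFMTest f → ∀ n x y, |(markovOp κ)^[n] f x - (markovOp κ)^[n] f y|
      ≤ A * q ^ n * (1 + dist xbar x + dist xbar y))
    {μ : Measure X} [IsProbabilityMeasure μ] (hμ : ∫⁻ x, ENNReal.ofReal (dist xbar x) ∂μ < ⊤)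
    {f : X → ℝ} (hf : IsFMTest f) (n : ℕ) (x : X) :
    |∫ y, (markovOp κ)^[n] f y ∂μ - (markovOp κ)^[n] f x|
      ≤ A * q ^ n * (1 + dist xbar x + ∫ y, dist xbar y ∂μ) := by
  have hint := integrable_dist_of_lintegral_lt_top xbar hμ
  have hPf : Integrable ((markovOp κ)^[n] f) μ :=
    integrable_of_abs_le (measurable_iterate_markovOp κ hf.continuous.measurable n)
      (abs_iterate_markovOp_le κ hf.abs_le_one n)
  have h1 : ∫ y, (markovOp κ)^[n] f y ∂μ - (markovOp κ)^[n] f x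
      = ∫ y, ((markovOp κ)^[n] f y - (markovOp κ)^[n] f x) ∂μ := by
    rw [integral_sub hPf (integrable_const _)]; simp
  have h2 : ∫ y, A * q ^ n * (1 + dist xbar x + dist xbar y) ∂μ
      = A * q ^ n * (1 + dist xbar x + ∫ y, dist xbar y ∂μ) := by
    rw [integral_const_mul, integral_add (integrable_const _) hint]; simp
  rw [h1, ← h2]
  refine (abs_integral_le_integral_abs).trans (integral_mono (hPf.sub (integrable_const _)).abs
    (((integrable_const _).add hint).const_mul _) fun y => ?_)
  change |(markovOp κ)^[n] f y - (markovOp κ)^[n] f x| ≤ _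
  rw [abs_sub_comm]
  exact hcontr f hf n x y

/-- A Markov kernel satisfying a Lyapunov condition and whose iterates forget their starting
point geometrically fast on Fortet–Mourier test functions has a unique invariant probability
measure with a finite first moment, which attracts all probability measures. -/
theorem exists_invariant_of_contraction [CompleteSpace X] [SecondCountableTopology X]
    (κ : Kernel X X) [IsMarkovKernel κ] {xbar : X} {α c A q : ℝ}
    (hα0 : 0 ≤ α) (hα1 : α < 1) (hc : 0 ≤ c) (hA : 0 < A) (hq : q ∈ Set.Ioo (0 : ℝ) 1)
    (hlyap : ∀ x, ∫⁻ y, ENNReal.ofReal (dist xbar y) ∂κ x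
      ≤ ENNReal.ofReal (α * dist xbar x + c))
    (hcont : ∀ f, IsFMTest f → Continuous (markovOp κ f))
    (hcontr : ∀ f, IsFMTest f → ∀ n x y, |(markovOp κ)^[n] f x - (markovOp κ)^[n] f y|
      ≤ A * q ^ n * (1 + dist xbar x + dist xbar y)) :
    ∃ μstar : Measure X, IsProbabilityMeasure μstar ∧
      (∫⁻ x, ENNReal.ofReal (dist xbar x) ∂μstar < ⊤) ∧
      μstar.bind κ = μstar ∧
      (∀ μ' : Measure X, IsProbabilityMeasure μ' → μ'.bind κ = μ' → μ' = μstar) ∧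
      (∀ μ : Measure X, IsProbabilityMeasure μ →
        ∀ f : X → ℝ, Continuous f → (∃ M, ∀ x, |f x| ≤ M) →
        Tendsto (fun n => ∫ x, (markovOp κ)^[n] f x ∂μ) atTop (nhds (∫ x, f x ∂μstar))) ∧
      ∃ C : ℝ, 0 < C ∧ ∀ μ : Measure X, IsProbabilityMeasure μ →
          (∫⁻ x, ENNReal.ofReal (dist xbar x) ∂μ < ⊤) → ∀ n : ℕ,
          fmDist ((fun m : Measure X => m.bind κ)^[n] μ) μstar
            ≤ q ^ n * C * (1 + ∫ x, dist xbar x ∂μ) := by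
  set T : Measure X → Measure X := fun m => m.bind κ with hT
  let μs : ℕ → ProbabilityMeasure X := fun n => ⟨T^[n] (Measure.dirac xbar), inferInstance⟩
  have hμs (n : ℕ) : (μs n : Measure X) = T^[n] (Measure.dirac xbar) := rfl
  have hmom (n : ℕ) : ∫⁻ x, ENNReal.ofReal (dist xbar x) ∂(μs n : Measure X)
      ≤ ENNReal.ofReal (c / (1 - α)) :=
    lintegral_dist_iterate_bind_le κ hα0 hα1 hc hlyap n
  have hM : 0 ≤ c / (1 - α) := div_nonneg hc (by linarith)
  have hqlim : Tendsto (fun n => q ^ n) atTop (nhds 0) :=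
    tendsto_pow_atTop_nhds_zero_of_lt_one hq.1.le hq.2
  have hcauchy (f : X → ℝ) (hf : IsFMTest f) (N n : ℕ) (h : N ≤ n) :
      |∫ x, f x ∂(μs n : Measure X) - ∫ x, f x ∂(μs N : Measure X)|
        ≤ A * q ^ N * (1 + c / (1 - α)) := by
    obtain ⟨k, rfl⟩ := Nat.exists_eq_add_of_le h
    have h1 : (μs (N + k) : Measure X) = T^[N] (μs k : Measure X) := by
      rw [hμs, hμs, Function.iterate_add_apply]
    have hm := hf.continuous.measurable
    rw [h1, integral_iterate_bind κ _ hm hf.abs_le_one, hμs N,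
      integral_iterate_bind κ _ hm hf.abs_le_one,
      integral_dirac' _ _ (measurable_iterate_markovOp κ hm N).stronglyMeasurable]
    refine (abs_integral_iterate_sub_le κ hcontr ((hmom k).trans_lt ENNReal.ofReal_lt_top)
      hf N xbar).trans ?_
    have h2 : ∫ y, dist xbar y ∂(μs k : Measure X) ≤ c / (1 - α) := by
      have := hmom k
      rw [← ofReal_integral_eq_lintegral_ofReal (integrable_dist_of_lintegral_lt_top xbar
        (this.trans_lt ENNReal.ofReal_lt_top)) (ae_of_all _ fun _ => dist_nonneg)] at this
      exact (ENNReal.ofReal_le_ofReal_iff hM).1 this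
    have h3 : 0 ≤ A * q ^ N := mul_nonneg hA.le (pow_nonneg hq.1.le N)
    rw [dist_self]
    exact mul_le_mul_of_nonneg_left (by linarith) h3
  have hb : Tendsto (fun N => A * q ^ N * (1 + c / (1 - α))) atTop (nhds 0) := by
    simpa using (hqlim.const_mul A).mul_const (1 + c / (1 - α))
  obtain ⟨μstar, hlim⟩ := exists_tendsto_of_fm_cauchy hb hcauchy
  have hmomstar : ∫⁻ x, ENNReal.ofReal (dist xbar x) ∂(μstar : Measure X) < ⊤ :=
    (lintegral_dist_le_of_tendsto hlim hmom).trans_lt ENNReal.ofReal_lt_top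
  have hlimf (f : X → ℝ) (hf : Continuous f) (M : ℝ) (hM : ∀ x, |f x| ≤ M) :
      Tendsto (fun n => ∫ x, f x ∂(μs n : Measure X)) atTop
        (nhds (∫ x, f x ∂(μstar : Measure X))) :=
    (ProbabilityMeasure.tendsto_iff_forall_integral_tendsto.1 hlim)
      (BoundedContinuousFunction.ofNormedAddCommGroup f hf M hM)
  have hinv : (μstar : Measure X).bind κ = μstar := by
    refine Measure.eq_of_forall_isFMTest fun f hf => ?_
    rw [integral_bind_eq_integral_markovOp κ _ hf.continuous.measurable hf.abs_le_one]
    refine tendsto_nhds_unique (hlimf _ (hcont f hf) 1 (abs_markovOp_le κ hf.abs_le_one)) ?_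
    have h1 := (tendsto_add_atTop_iff_nat 1).2 (hlimf f hf.continuous 1 hf.abs_le_one)
    refine h1.congr fun n => ?_
    rw [hμs (n + 1), Function.iterate_succ_apply', ← hμs n]
    exact integral_bind_eq_integral_markovOp κ _ hf.continuous.measurable hf.abs_le_one
  have hinvf (f : X → ℝ) (hf : IsFMTest f) (n : ℕ) :
      ∫ x, (markovOp κ)^[n] f x ∂(μstar : Measure X) = ∫ x, f x ∂(μstar : Measure X) := by
    rw [← integral_iterate_bind κ _ hf.continuous.measurable hf.abs_le_one,
      Function.iterate_fixed hinv]
  set m : ℝ := ∫ y, dist xbar y ∂(μstar : Measure X) with hm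
  have hm0 : 0 ≤ m := integral_nonneg fun _ => dist_nonneg
  have hpt (f : X → ℝ) (hf : IsFMTest f) (n : ℕ) (x : X) :
      |(markovOp κ)^[n] f x - ∫ x, f x ∂(μstar : Measure X)|
        ≤ A * q ^ n * (1 + dist xbar x + m) := by
    rw [← hinvf f hf n, abs_sub_comm]
    exact abs_integral_iterate_sub_le κ hcontr hmomstar hf n x
  let orbit (μ : Measure X) [IsProbabilityMeasure μ] (n : ℕ) : ProbabilityMeasure X :=
    ⟨T^[n] μ, inferInstance⟩
  have hattr (μ : Measure X) [IsProbabilityMeasure μ] :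
      Tendsto (orbit μ) atTop (nhds μstar) := by
    refine ProbabilityMeasure.tendsto_of_forall_isFMTest fun f hf => ?_
    change Tendsto (fun n => ∫ x, f x ∂(T^[n] μ)) atTop _
    simp_rw [hT, integral_iterate_bind κ μ hf.continuous.measurable hf.abs_le_one]
    have h1 := tendsto_integral_of_dominated_convergence (μ := μ)
      (F := fun n x => (markovOp κ)^[n] f x) (f := fun _ => ∫ x, f x ∂(μstar : Measure X))
      (fun _ => (1 : ℝ))
      (fun n => (measurable_iterate_markovOp κ hf.continuous.measurable n).aestronglyMeasurable)
      (integrable_const _) (fun n => ae_of_all _ (abs_iterate_markovOp_le κ hf.abs_le_one n))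
      (ae_of_all _ fun x => ?_)
    · simpa using h1
    · refine tendsto_iff_dist_tendsto_zero.2 (squeeze_zero (fun _ => dist_nonneg)
        (fun n => hpt f hf n x) ?_)
      simpa using (hqlim.const_mul A).mul_const (1 + dist xbar x + m)
  refine ⟨μstar, inferInstance, hmomstar, hinv, fun μ' _ hμ' => ?_, fun μ _ f hf hM => ?_,
    A * (1 + m), by positivity, fun μ _ hμ n => fmDist_le fun f hf => ?_⟩
  · have h1 := hattr μ'
    have h2 : orbit μ' = fun _ => orbit μ' 0 :=
      funext fun n => Subtype.ext (Function.iterate_fixed hμ' n)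
    rw [h2] at h1
    exact congrArg ProbabilityMeasure.toMeasure (tendsto_nhds_unique tendsto_const_nhds h1)
  · obtain ⟨M, hM⟩ := hM
    have h1 := (ProbabilityMeasure.tendsto_iff_forall_integral_tendsto.1 (hattr μ))
      (BoundedContinuousFunction.ofNormedAddCommGroup f hf M hM)
    exact h1.congr fun n => integral_iterate_bind κ μ hf.measurable hM n
  · have hPf : Integrable ((markovOp κ)^[n] f) μ :=
      integrable_of_abs_le (measurable_iterate_markovOp κ hf.continuous.measurable n)
        (abs_iterate_markovOp_le κ hf.abs_le_one n)
    have hint := integrable_dist_of_lintegral_lt_top xbar hμ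
    rw [integral_iterate_bind κ μ hf.continuous.measurable hf.abs_le_one]
    have h1 : ∫ y, (markovOp κ)^[n] f y ∂μ - ∫ x, f x ∂(μstar : Measure X)
        = ∫ y, ((markovOp κ)^[n] f y - ∫ x, f x ∂(μstar : Measure X)) ∂μ := by
      rw [integral_sub hPf (integrable_const _)]; simp
    have h2 : ∫ y, A * q ^ n * (1 + dist xbar y + m) ∂μ
        = A * q ^ n * (1 + ∫ y, dist xbar y ∂μ + m) := by
      have hint1 : Integrable (fun y => 1 + dist xbar y) μ := (integrable_const _).add hint
      rw [integral_const_mul, integral_add hint1 (integrable_const _),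
        integral_add (integrable_const _) hint]
      simp
    rw [h1]
    refine (abs_integral_le_integral_abs).trans ((integral_mono
      (hPf.sub (integrable_const _)).abs
      ((((integrable_const _).add hint).add (integrable_const _)).const_mul _)
      fun y => hpt f hf n y).trans ?_)
    have h3 : 0 ≤ A * q ^ n := mul_nonneg hA.le (pow_nonneg hq.1.le n)
    have h4 : 0 ≤ ∫ y, dist xbar y ∂μ := integral_nonneg fun _ => dist_nonneg
    have h5 : 1 + ∫ y, dist xbar y ∂μ + m ≤ (1 + m) * (1 + ∫ y, dist xbar y ∂μ) := by nlinarith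
    refine h2.le.trans ((mul_le_mul_of_nonneg_left h5 h3).trans_eq ?_)
    ring

end Ergodic

section Gauge

/-- A bounded gauge of the distance which is contracted both by a Hölder-type bound at small scales
and by the bound coming from a contraction of probability `δ` at all scales. -/
structure IsContractionGauge (α l p δ K R s : ℝ) (G : ℝ → ℝ) : Prop where
  measurable : Measurable G
  nonneg : ∀ r, 0 ≤ r → 0 ≤ G r
  le_one : ∀ r, 0 ≤ r → G r ≤ 1
  monotoneOn : MonotoneOn G (Set.Ici 0)
  le_rpow : ∀ r, 0 ≤ r → G r ≤ K * r ^ p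
  contract : ∀ r e, 0 ≤ r → e ≤ K * (α * r) ^ p + l * r ^ p → e ≤ 1 - δ * (1 - G (α * r)) →
    e ≤ G r ∧ (r ≤ R → e ≤ (1 - s) * G r)

theorem exists_isContractionGauge {α l p δ R : ℝ} (hα : α ∈ Set.Ioo (0 : ℝ) 1) (hl : 0 < l)
    (hp : p ∈ Set.Ioc (0 : ℝ) 1) (hδ : δ ∈ Set.Ioo (0 : ℝ) 1) :
    ∃ (G : ℝ → ℝ) (K s c : ℝ), 0 < K ∧ s ∈ Set.Ioo (0 : ℝ) 1 ∧ 0 < c ∧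
      IsContractionGauge α l p δ K R s G ∧ ∀ r, 0 ≤ r → c * min 1 r ^ 2 ≤ G r := by
  obtain ⟨hα0, hα1⟩ := hα
  obtain ⟨hp0, hp1⟩ := hp
  obtain ⟨hδ0, hδ1⟩ := hδ
  set κ : ℝ := α ^ p with hκ
  have hκ0 : 0 < κ := Real.rpow_pos_of_pos hα0 p
  have hκ1 : κ < 1 := Real.rpow_lt_one hα0.le hα1 hp0
  set K : ℝ := 2 * l / (1 - κ) with hK
  have hK0 : 0 < K := div_pos (by linarith) (by linarith)
  have hlK : l = K * ((1 - κ) / 2) := by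
    have : 1 - κ ≠ 0 := by linarith
    rw [hK]; field_simp
  set r₁ : ℝ := (1 / (2 * K)) ^ (1 / p) with hr₁
  have hr₁0 : 0 < r₁ := Real.rpow_pos_of_pos (by positivity) _
  have hr₁p : K * r₁ ^ p = 1 / 2 := by
    rw [hr₁, ← Real.rpow_mul (by positivity), one_div_mul_cancel hp0.ne', Real.rpow_one]
    field_simp
  obtain ⟨k, hk⟩ := exists_pow_lt_of_lt_one (show 0 < δ / 2 by linarith) hα1
  set m : ℝ → ℝ := fun r => (r₁ / max r₁ r) ^ k with hm
  have hmax (r : ℝ) : 0 < max r₁ r := lt_max_of_lt_left hr₁0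
  have hm0 (r : ℝ) : 0 < m r := pow_pos (div_pos hr₁0 (hmax r)) k
  have hm1 (r : ℝ) : m r ≤ 1 :=
    pow_le_one₀ (div_pos hr₁0 (hmax r)).le ((div_le_one (hmax r)).2 (le_max_left _ _))
  have hmanti : Antitone m := fun a b hab =>
    pow_le_pow_left₀ (div_pos hr₁0 (hmax b)).le
      (div_le_div_of_nonneg_left hr₁0.le (hmax a) (max_le_max_left _ hab)) k
  have hmmeas : Measurable m := by fun_prop
  set s : ℝ := min ((1 - κ) / 2) (δ / 4 * m R) with hs
  have hs0 : 0 < s := lt_min (by linarith) (mul_pos (by linarith) (hm0 R))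
  have hs1 : s < 1 := (min_le_left _ _).trans_lt (by linarith)
  set G : ℝ → ℝ := fun r => min (K * r ^ p) (1 - δ / 4 * m r) with hG
  have hGK (r : ℝ) : G r ≤ K * r ^ p := min_le_left _ _
  have hGm (r : ℝ) : G r ≤ 1 - δ / 4 * m r := min_le_right _ _
  have hδm (r : ℝ) : 0 < δ / 4 * m r := mul_pos (by linarith) (hm0 r)
  have hδm1 (r : ℝ) : δ / 4 * m r ≤ 1 / 4 := by nlinarith [hm1 r, hm0 r]
  have hG0 (r : ℝ) (hr : 0 ≤ r) : 0 ≤ G r :=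
    le_min (mul_nonneg hK0.le (Real.rpow_nonneg hr p)) (by linarith [hδm1 r])
  refine ⟨G, K, s, min K (3 / 4), hK0, ⟨hs0, hs1⟩, lt_min hK0 (by norm_num), ?_, fun r hr => ?_⟩
  · refine ⟨?_, hG0, fun r _ => (hGm r).trans (by linarith [hδm r]), ?_, fun r _ => hGK r, ?_⟩
    · have : Measurable fun r : ℝ => r ^ p := (Real.continuous_rpow_const hp0.le).measurable
      exact (this.const_mul K).min (measurable_const.sub (hmmeas.const_mul _))
    · intro a ha b _ hab
      refine min_le_min (mul_le_mul_of_nonneg_left (Real.rpow_le_rpow ha hab hp0.le) hK0.le) ?_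
      have := mul_le_mul_of_nonneg_left (hmanti hab) (show 0 ≤ δ / 4 by linarith)
      linarith
    · intro r e hr h1 h2
      rw [Real.mul_rpow hα0.le hr] at h1
      have hrp : 0 ≤ r ^ p := Real.rpow_nonneg hr p
      suffices h : ∃ t, 0 ≤ t ∧ e ≤ (1 - t) * G r ∧ (r ≤ R → s ≤ t) by
        obtain ⟨t, ht0, ht, hts⟩ := h
        have hGr := hG0 r hr
        exact ⟨ht.trans (by nlinarith), fun hrR => ht.trans
          (mul_le_mul_of_nonneg_right (by linarith [hts hrR]) hGr)⟩
      rcases min_choice (K * r ^ p) (1 - δ / 4 * m r) with h | h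
      · refine ⟨(1 - κ) / 2, by linarith, ?_, fun _ => min_le_left _ _⟩
        change e ≤ _ * min _ _
        rw [h]
        refine h1.trans (le_of_eq ?_)
        rw [← hκ, hlK]
        ring
      · refine ⟨δ / 4 * m r, (hδm r).le, ?_, fun hrR => (min_le_right _ _).trans
          (mul_le_mul_of_nonneg_left (hmanti hrR) (by linarith))⟩
        change e ≤ _ * min _ _
        rw [h]
        suffices h3 : 2 * (δ / 4 * m r) ≤ δ * (1 - G (α * r)) by
          nlinarith [sq_nonneg (δ / 4 * m r)]
        rcases lt_or_ge (α * r) r₁ with h4 | h4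
        · have h5 : G (α * r) ≤ 1 / 2 := by
            refine (hGK _).trans (le_trans ?_ hr₁p.le)
            exact mul_le_mul_of_nonneg_left
              (Real.rpow_le_rpow (mul_nonneg hα0.le hr) h4.le hp0.le) hK0.le
          nlinarith [hm1 r]
        · have h5 : r₁ ≤ r := h4.trans (by nlinarith)
          have h6 : m r = α ^ k * m (α * r) := by
            simp only [hm]
            have : 0 < r := hr₁0.trans_le h5
            rw [max_eq_right h4, max_eq_right h5, ← mul_pow]
            congr 1
            field_simp
          have h7 : m r ≤ δ / 2 * m (α * r) := by
            rw [h6]; exact mul_le_mul_of_nonneg_right hk.le (hm0 _).le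
          have h8 := hGm (α * r)
          nlinarith
  · have hmin0 : 0 ≤ min 1 r := le_min zero_le_one hr
    have hmin1 : min 1 r ≤ 1 := min_le_left _ _
    refine le_min ?_ ?_
    · have h1 : min 1 r ^ 2 ≤ r ^ p := by
        rcases le_total 1 r with h | h
        · rw [min_eq_left h, one_pow]; exact Real.one_le_rpow h hp0.le
        · rw [min_eq_right h]
          calc r ^ 2 ≤ r := by nlinarith
            _ = r ^ (1 : ℝ) := (Real.rpow_one r).symm
            _ ≤ r ^ p := Real.rpow_le_rpow_of_exponent_ge_of_imp hr h hp1
                (fun _ h0 => absurd h0 one_ne_zero)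
      exact mul_le_mul (min_le_left _ _) h1 (by positivity) hK0.le
    · have h1 : min 1 r ^ 2 ≤ 1 := pow_le_one₀ hmin0 hmin1
      have h2 : min K (3 / 4) ≤ 3 / 4 := min_le_right _ _
      have h3 : 0 < min K (3 / 4) := lt_min hK0 (by norm_num)
      nlinarith [hδm1 r]

end Gauge

section Coupling

variable {Θ : Type*} [MeasurableSpace Θ]

/-- The coupling of two probability measures which moves their common part along the diagonal. -/
theorem exists_coupling (μ ν : Measure Θ) [IsProbabilityMeasure μ] [IsProbabilityMeasure ν] :
    ∃ γ ρ : Measure (Θ × Θ), γ = (μ ⊓ ν).map (fun θ => (θ, θ)) + ρ ∧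
      γ.map Prod.fst = μ ∧ γ.map Prod.snd = ν := by
  have : IsFiniteMeasure (μ ⊓ ν) := isFiniteMeasure_of_le μ inf_le_left
  set a := μ - μ ⊓ ν with ha
  set b := ν - μ ⊓ ν with hb
  have haμ : a + μ ⊓ ν = μ := Measure.sub_add_cancel_of_le inf_le_left
  have hbν : b + μ ⊓ ν = ν := Measure.sub_add_cancel_of_le inf_le_right
  have hau : a univ = 1 - (μ ⊓ ν) univ := by
    rw [ha, Measure.sub_apply .univ inf_le_left, measure_univ]
  have hbu : b univ = a univ := by
    rw [hau, hb, Measure.sub_apply .univ inf_le_right, measure_univ]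
  have hfin : a univ ≠ ⊤ := by rw [hau]; exact ENNReal.sub_ne_top ENNReal.one_ne_top
  have : IsFiniteMeasure a := ⟨hfin.lt_top⟩
  have : IsFiniteMeasure b := ⟨by rw [hbu]; exact hfin.lt_top⟩
  have hscale (η : Measure Θ) (hη : η univ = a univ) : (a univ)⁻¹ • a univ • η = η := by
    rcases eq_or_ne (a univ) 0 with h | h
    · rw [Measure.measure_univ_eq_zero.1 (hη.trans h)]; simp
    · rw [smul_smul, ENNReal.inv_mul_cancel h hfin, one_smul]
  have hdiag : Measurable fun θ : Θ => (θ, θ) := measurable_id.prodMk measurable_id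
  refine ⟨_, (a univ)⁻¹ • a.prod b, rfl, ?_, ?_⟩
  · rw [Measure.map_add _ _ measurable_fst, Measure.map_map measurable_fst hdiag,
      Measure.map_smul, Measure.map_fst_prod, hbu, hscale a rfl]
    change Measure.map id _ + a = μ
    rw [Measure.map_id, add_comm, haμ]
  · rw [Measure.map_add _ _ measurable_snd, Measure.map_map measurable_snd hdiag,
      Measure.map_smul, Measure.map_snd_prod, hscale b hbu]
    change Measure.map id _ + b = ν
    rw [Measure.map_id, add_comm, hbν]

theorem two_mul_sub_le_tvNorm (μ ν : Measure Θ) [IsProbabilityMeasure μ] [IsProbabilityMeasure ν]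
    {A : Set Θ} (hA : MeasurableSet A) : 2 * (μ.real A - ν.real A) ≤ tvNorm μ ν := by
  refine le_csSup ⟨2, ?_⟩ ⟨A, hA, ?_⟩
  · rintro _ ⟨B, -, rfl⟩
    simp only [← measureReal_def]
    linarith [measureReal_le_one (μ := μ) (s := B), measureReal_le_one (μ := ν) (s := Bᶜ),
      measureReal_nonneg (μ := ν) (s := B), measureReal_nonneg (μ := μ) (s := Bᶜ)]
  · simp only [← measureReal_def]
    rw [probReal_compl_eq_one_sub hA, probReal_compl_eq_one_sub hA]
    ring

theorem abs_measureReal_sub_le_tvNorm (μ ν : Measure Θ) [IsProbabilityMeasure μ]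
    [IsProbabilityMeasure ν] {A : Set Θ} (hA : MeasurableSet A) :
    |μ.real A - ν.real A| ≤ tvNorm μ ν := by
  have h1 := two_mul_sub_le_tvNorm μ ν hA
  have h2 := two_mul_sub_le_tvNorm μ ν hA.compl
  rw [probReal_compl_eq_one_sub hA, probReal_compl_eq_one_sub hA] at h2
  rw [abs_le]
  constructor <;> linarith

theorem one_sub_inf_univ_le_tvNorm (μ ν : Measure Θ) [IsProbabilityMeasure μ]
    [IsProbabilityMeasure ν] : 1 - (μ ⊓ ν).real univ ≤ tvNorm μ ν := by
  have : IsFiniteMeasure (μ ⊓ ν) := isFiniteMeasure_of_le μ inf_le_left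
  have key : ENNReal.ofReal (1 - tvNorm μ ν) ≤ (μ ⊓ ν) univ := by
    rw [Measure.inf_apply .univ]
    refine le_sInf ?_
    rintro _ ⟨t, rfl⟩
    rw [inter_univ, inter_univ]
    have hT := measurableSet_toMeasurable μ t
    have h1 : ν (toMeasurable μ t)ᶜ ≤ ν tᶜ :=
      measure_mono (compl_subset_compl.2 (subset_toMeasurable μ t))
    refine le_trans ?_ (add_le_add (measure_toMeasurable t).le h1)
    rw [← ofReal_measureReal, ← ofReal_measureReal, ← ENNReal.ofReal_add measureReal_nonneg
      measureReal_nonneg, probReal_compl_eq_one_sub hT]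
    refine ENNReal.ofReal_le_ofReal ?_
    have := (abs_le.1 (abs_measureReal_sub_le_tvNorm μ ν hT)).1
    linarith
  have := (ENNReal.ofReal_le_iff_le_toReal (measure_ne_top _ _)).1 key
  rw [← measureReal_def] at this
  linarith

theorem integral_coupling_le {μ ν : Measure Θ} [IsProbabilityMeasure μ] [IsProbabilityMeasure ν]
    {γ ρ : Measure (Θ × Θ)} (hγ : γ = (μ ⊓ ν).map (fun θ => (θ, θ)) + ρ)
    (hγμ : γ.map Prod.fst = μ) {g : Θ × Θ → ℝ} (hg : Measurable g) (hg0 : ∀ z, 0 ≤ g z)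
    (hg1 : ∀ z, g z ≤ 1) :
    ∫ z, g z ∂γ ≤ ∫ θ, g (θ, θ) ∂(μ ⊓ ν) + (1 - (μ ⊓ ν).real univ) := by
  have : IsFiniteMeasure (μ ⊓ ν) := isFiniteMeasure_of_le μ inf_le_left
  have hdiag : Measurable fun θ : Θ => (θ, θ) := measurable_id.prodMk measurable_id
  have hγu : γ univ = 1 := by
    rw [← measure_univ (μ := μ), ← hγμ, Measure.map_apply measurable_fst .univ, preimage_univ]
  have : IsFiniteMeasure γ := ⟨by simp [hγu]⟩
  have : IsFiniteMeasure ρ := isFiniteMeasure_of_le γ (by rw [hγ]; exact Measure.le_add_left le_rfl)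
  have hgb (z : Θ × Θ) : |g z| ≤ 1 := by rw [abs_of_nonneg (hg0 z)]; exact hg1 z
  have hρ : ρ.real univ = 1 - (μ ⊓ ν).real univ := by
    have h1 : γ.real univ = 1 := by simp [measureReal_def, hγu]
    have h2 : ((μ ⊓ ν).map fun θ => (θ, θ)).real univ = (μ ⊓ ν).real univ := by
      rw [measureReal_def, Measure.map_apply hdiag .univ, preimage_univ, measureReal_def]
    rw [hγ, measureReal_add_apply, h2] at h1
    linarith
  have h3 : ∫ z, g z ∂ρ ≤ ρ.real univ := by
    calc ∫ z, g z ∂ρ ≤ ∫ _, (1 : ℝ) ∂ρ :=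
          integral_mono (integrable_of_abs_le hg hgb) (integrable_const _) hg1
      _ = ρ.real univ := by simp
  rw [← hρ, hγ, integral_add_measure (integrable_of_abs_le hg hgb) (integrable_of_abs_le hg hgb),
    integral_map hdiag.aemeasurable hg.aestronglyMeasurable]
  linarith

end Coupling

section OneStep

theorem abs_integral_le_of_abs_le_sqrt_mul {Y : Type*} [MeasurableSpace Y] {γ : Measure Y}
    {h g w : Y → ℝ} {A a b G W : ℝ} (hA : 0 ≤ A) (hG : 0 < G) (hW : 0 < W)
    (hg : Integrable g γ) (hw : Integrable w γ) (hg0 : ∀ z, 0 ≤ g z) (hw0 : ∀ z, 0 ≤ w z)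
    (hh : ∀ z, |h z| ≤ A * √(g z * w z))
    (hga : ∫ z, g z ∂γ ≤ a * G) (hwb : ∫ z, w z ∂γ ≤ b * W) :
    |∫ z, h z ∂γ| ≤ A * ((a + b) / 2) * √(G * W) := by
  have hrG : 0 < √G := Real.sqrt_pos.2 hG
  have hrW : 0 < √W := Real.sqrt_pos.2 hW
  have hG2 : √G * √G = G := Real.mul_self_sqrt hG.le
  have hW2 : √W * √W = W := Real.mul_self_sqrt hW.le
  set t : ℝ := √W / √G with ht
  set t' : ℝ := √G / √W with ht'
  have htt : t * t' = 1 := by rw [ht, ht']; field_simp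
  have ht0 : 0 < t := div_pos hrW hrG
  have ht0' : 0 < t' := div_pos hrG hrW
  have hpt (z : Y) : |h z| ≤ A * ((t * g z + t' * w z) / 2) := by
    refine (hh z).trans (mul_le_mul_of_nonneg_left ?_ hA)
    have h1 : 0 ≤ t * g z := mul_nonneg ht0.le (hg0 z)
    have h2 : 0 ≤ t' * w z := mul_nonneg ht0'.le (hw0 z)
    refine Real.sqrt_le_iff.2 ⟨by linarith, ?_⟩
    have h3 : g z * w z = (t * g z) * (t' * w z) := by
      linear_combination (-(g z * w z)) * htt
    rw [h3]
    nlinarith [sq_nonneg (t * g z - t' * w z)]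
  have hint : Integrable (fun z => A * ((t * g z + t' * w z) / 2)) γ :=
    (((hg.const_mul t).add (hw.const_mul t')).div_const 2).const_mul A
  have h1 : |∫ z, h z ∂γ| ≤ ∫ z, A * ((t * g z + t' * w z) / 2) ∂γ :=
    norm_integral_le_of_norm_le (f := h) hint (ae_of_all _ hpt)
  rw [integral_const_mul, integral_div, integral_add (hg.const_mul t) (hw.const_mul t'),
    integral_const_mul, integral_const_mul] at h1
  refine h1.trans ?_
  rw [mul_assoc A]
  refine mul_le_mul_of_nonneg_left ?_ hA
  have h2 : t * G = √(G * W) := by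
    rw [Real.sqrt_mul hG.le, ht]
    nth_rewrite 2 [← hG2]
    field_simp
  have h3 : t' * W = √(G * W) := by
    rw [Real.sqrt_mul hG.le, ht']
    nth_rewrite 2 [← hW2]
    field_simp
  have h4 := mul_le_mul_of_nonneg_left hga ht0.le
  have h5 := mul_le_mul_of_nonneg_left hwb ht0'.le
  have h6 : t * (a * G) = a * √(G * W) := by rw [← h2]; ring
  have h7 : t' * (b * W) = b * √(G * W) := by rw [← h3]; ring
  linarith

variable {X Θ : Type*} [MetricSpace X] [SecondCountableTopology X] [MeasurableSpace X]
  [BorelSpace X] [MeasurableSpace Θ]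

theorem integral_gauge_coupling_le {μ ν : Measure Θ} [IsProbabilityMeasure μ]
    [IsProbabilityMeasure ν] {γ ρ : Measure (Θ × Θ)}
    (hγ : γ = (μ ⊓ ν).map (fun θ => (θ, θ)) + ρ) (hγμ : γ.map Prod.fst = μ)
    {u v : Θ → X} (hu : Measurable u) (hv : Measurable v)
    {α l p δ K R s D : ℝ} {G : ℝ → ℝ} (hG : IsContractionGauge α l p δ K R s G)
    (hp : p ∈ Set.Ioc (0 : ℝ) 1) (hα : 0 ≤ α) (hK : 0 ≤ K) (hD : 0 ≤ D)
    (hmean : ∫⁻ θ, ENNReal.ofReal (dist (u θ) (v θ)) ∂μ ≤ ENNReal.ofReal (α * D))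
    (htv : tvNorm μ ν ≤ l * D ^ p)
    (hover : ENNReal.ofReal δ < (μ ⊓ ν) {θ | dist (u θ) (v θ) ≤ α * D}) :
    ∫ z, G (dist (u z.1) (v z.2)) ∂γ ≤ G D ∧
      (D ≤ R → ∫ z, G (dist (u z.1) (v z.2)) ∂γ ≤ (1 - s) * G D) := by
  have : IsFiniteMeasure (μ ⊓ ν) := isFiniteMeasure_of_le μ inf_le_left
  have hαD : 0 ≤ α * D := mul_nonneg hα hD
  have hdist : Measurable fun θ => dist (u θ) (v θ) := hu.dist hv
  have hGd : Measurable fun θ => G (dist (u θ) (v θ)) := hG.measurable.comp hdist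
  have hGabs (θ : Θ) : |G (dist (u θ) (v θ))| ≤ 1 := by
    rw [abs_of_nonneg (hG.nonneg _ dist_nonneg)]; exact hG.le_one _ dist_nonneg
  have hle := integral_coupling_le hγ hγμ (g := fun z => G (dist (u z.1) (v z.2)))
    (hG.measurable.comp ((hu.comp measurable_fst).dist (hv.comp measurable_snd)))
    (fun _ => hG.nonneg _ dist_nonneg) (fun _ => hG.le_one _ dist_nonneg)
  refine hG.contract D _ hD ?_ ?_
  · have hdint : Integrable (fun θ => dist (u θ) (v θ)) μ :=
      ⟨hdist.aestronglyMeasurable, (hasFiniteIntegral_iff_ofReal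
        (ae_of_all _ fun _ => dist_nonneg)).2 (hmean.trans_lt ENNReal.ofReal_lt_top)⟩
    have hdmean : ∫ θ, dist (u θ) (v θ) ∂μ ≤ α * D := by
      rw [integral_eq_lintegral_of_nonneg_ae (ae_of_all _ fun _ => dist_nonneg)
        hdist.aestronglyMeasurable]
      exact ENNReal.toReal_le_of_le_ofReal hαD hmean
    have hpint : Integrable (fun θ => dist (u θ) (v θ) ^ p) μ := by
      refine ((integrable_const (1 : ℝ)).add hdint).mono'
        (hdist.pow_const p).aestronglyMeasurable (ae_of_all _ fun θ => ?_)
      have h0 : 0 ≤ dist (u θ) (v θ) := dist_nonneg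
      rw [Real.norm_of_nonneg (Real.rpow_nonneg h0 p)]
      simp only [Pi.add_apply]
      rcases le_total (dist (u θ) (v θ)) 1 with h | h
      · linarith [Real.rpow_le_one h0 h hp.1.le]
      · have := Real.rpow_le_rpow_of_exponent_le h hp.2
        rw [Real.rpow_one] at this
        linarith
    have hjensen : ∫ θ, dist (u θ) (v θ) ^ p ∂μ ≤ (∫ θ, dist (u θ) (v θ) ∂μ) ^ p :=
      (Real.concaveOn_rpow hp.1.le hp.2).le_map_integral
        (Real.continuous_rpow_const hp.1.le).continuousOn isClosed_Ici
        (ae_of_all _ fun _ => mem_Ici.2 dist_nonneg) hdint hpint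
    have h1 : ∫ θ, G (dist (u θ) (v θ)) ∂(μ ⊓ ν) ≤ ∫ θ, G (dist (u θ) (v θ)) ∂μ :=
      integral_mono_measure inf_le_left (ae_of_all _ fun _ => hG.nonneg _ dist_nonneg)
        (integrable_of_abs_le hGd hGabs)
    have h2 : ∫ θ, G (dist (u θ) (v θ)) ∂μ ≤ ∫ θ, K * dist (u θ) (v θ) ^ p ∂μ :=
      integral_mono (integrable_of_abs_le hGd hGabs) (hpint.const_mul K)
        fun _ => hG.le_rpow _ dist_nonneg
    rw [integral_const_mul] at h2
    have h3 : (∫ θ, dist (u θ) (v θ) ∂μ) ^ p ≤ (α * D) ^ p :=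
      Real.rpow_le_rpow (integral_nonneg fun _ => dist_nonneg) hdmean hp.1.le
    have h4 := mul_le_mul_of_nonneg_left (hjensen.trans h3) hK
    have h5 := one_sub_inf_univ_le_tvNorm μ ν
    simp only at hle
    linarith
  · set B : Set Θ := {θ | dist (u θ) (v θ) ≤ α * D} with hB
    have hBm : MeasurableSet B := measurableSet_le hdist measurable_const
    have hBδ : δ ≤ (μ ⊓ ν).real B :=
      (ENNReal.ofReal_le_iff_le_toReal (measure_ne_top _ _)).1 hover.le
    have hpt (θ : Θ) : G (dist (u θ) (v θ)) ≤ 1 - B.indicator (fun _ => 1 - G (α * D)) θ := by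
      by_cases h : θ ∈ B
      · rw [indicator_of_mem h]
        have := hG.monotoneOn (mem_Ici.2 (dist_nonneg (x := u θ) (y := v θ))) (mem_Ici.2 hαD) h
        linarith
      · rw [indicator_of_notMem h]
        linarith [hG.le_one _ (dist_nonneg (x := u θ) (y := v θ))]
    have hind : Integrable (B.indicator fun _ => 1 - G (α * D)) (μ ⊓ ν) :=
      (integrable_const _).indicator hBm
    have h1 := integral_mono (integrable_of_abs_le hGd hGabs)
      ((integrable_const (1 : ℝ)).sub hind) hpt
    rw [integral_sub' (integrable_const _) hind, integral_indicator_const _ hBm] at h1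
    simp only [integral_const, smul_eq_mul, mul_one] at h1
    have h2 := mul_le_mul_of_nonneg_right hBδ (sub_nonneg.2 (hG.le_one _ hαD))
    simp only at hle
    linarith

theorem abs_integral_sub_integral_le {μ ν : Measure Θ} [IsProbabilityMeasure μ]
    [IsProbabilityMeasure ν] {u v : Θ → X} (hu : Measurable u) (hv : Measurable v)
    {α l p δ K R s D : ℝ} {G : ℝ → ℝ} (hG : IsContractionGauge α l p δ K R s G)
    (hp : p ∈ Set.Ioc (0 : ℝ) 1) (hα : 0 ≤ α) (hK : 0 ≤ K) (hD : 0 ≤ D) (hGD : 0 < G D)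
    (hmean : ∫⁻ θ, ENNReal.ofReal (dist (u θ) (v θ)) ∂μ ≤ ENNReal.ofReal (α * D))
    (htv : tvNorm μ ν ≤ l * D ^ p)
    (hover : ENNReal.ofReal δ < (μ ⊓ ν) {θ | dist (u θ) (v θ) ≤ α * D})
    {xbar : X} {c β q d₁ d₂ : ℝ} (hc : 0 ≤ c) (hβ : 0 ≤ β) (hd₁ : 0 ≤ d₁) (hd₂ : 0 ≤ d₂)
    (hDd : D ≤ d₁ + d₂)
    (hμ : ∫⁻ θ, ENNReal.ofReal (dist xbar (u θ)) ∂μ ≤ ENNReal.ofReal (α * d₁ + c))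
    (hν : ∫⁻ θ, ENNReal.ofReal (dist xbar (v θ)) ∂ν ≤ ENNReal.ofReal (α * d₂ + c))
    (hnear : ∀ U, 0 ≤ U → 1 + β * (2 * c + α * U) ≤ (2 * q - 1 + s) * (1 + β * U))
    (hfar : ∀ U, R < U → 1 + β * (2 * c + α * U) ≤ (2 * q - 1) * (1 + β * U))
    {f : X → ℝ} (hf : Measurable f) {M A : ℝ} (hM : ∀ x, |f x| ≤ M) (hA : 0 ≤ A)
    (hfG : ∀ a b, |f a - f b|
      ≤ A * √(G (dist a b) * (1 + β * (dist xbar a + dist xbar b)))) :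
    |∫ θ, f (u θ) ∂μ - ∫ θ, f (v θ) ∂ν|
      ≤ A * q * √(G D * (1 + β * (d₁ + d₂))) := by
  obtain ⟨γ, ρ, hγ, hγμ, hγν⟩ := exists_coupling μ ν
  have : IsProbabilityMeasure γ := by
    constructor
    rw [← measure_univ (μ := μ), ← hγμ, Measure.map_apply measurable_fst .univ, preimage_univ]
  obtain ⟨hG1, hG2⟩ := integral_gauge_coupling_le hγ hγμ hu hv hG hp hα hK hD hmean htv hover
  have hu' : Measurable fun z : Θ × Θ => u z.1 := hu.comp measurable_fst
  have hv' : Measurable fun z : Θ × Θ => v z.2 := hv.comp measurable_snd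
  have hmom {η : Measure Θ} {w : Θ → X} {a : ℝ} (hw : Measurable w) (ha : 0 ≤ a)
      (h : ∫⁻ θ, ENNReal.ofReal (dist xbar (w θ)) ∂η ≤ ENNReal.ofReal a) :
      Integrable (fun θ => dist xbar (w θ)) η ∧ ∫ θ, dist xbar (w θ) ∂η ≤ a := by
    have hm : Measurable fun θ => dist xbar (w θ) := measurable_const.dist hw
    refine ⟨⟨hm.aestronglyMeasurable, (hasFiniteIntegral_iff_ofReal
      (ae_of_all _ fun _ => dist_nonneg)).2 (h.trans_lt ENNReal.ofReal_lt_top)⟩, ?_⟩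
    rw [integral_eq_lintegral_of_nonneg_ae (ae_of_all _ fun _ => dist_nonneg)
      hm.aestronglyMeasurable]
    exact ENNReal.toReal_le_of_le_ofReal ha h
  have hfst {h : Θ → ℝ} (hh : Measurable h) : ∫ z, h z.1 ∂γ = ∫ θ, h θ ∂μ := by
    rw [← hγμ, integral_map measurable_fst.aemeasurable hh.aestronglyMeasurable]
  have hsnd {h : Θ → ℝ} (hh : Measurable h) : ∫ z, h z.2 ∂γ = ∫ θ, h θ ∂ν := by
    rw [← hγν, integral_map measurable_snd.aemeasurable hh.aestronglyMeasurable]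
  obtain ⟨hiu, heu⟩ := hmom hu (by positivity) hμ
  obtain ⟨hiv, hev⟩ := hmom hv (by positivity) hν
  have hiu' : Integrable (fun z : Θ × Θ => dist xbar (u z.1)) γ := by
    rw [← hγμ] at hiu
    exact hiu.comp_measurable measurable_fst
  have hiv' : Integrable (fun z : Θ × Θ => dist xbar (v z.2)) γ := by
    rw [← hγν] at hiv
    exact hiv.comp_measurable measurable_snd
  have hU : 0 ≤ d₁ + d₂ := by linarith
  have hW : 0 < 1 + β * (d₁ + d₂) := by positivity
  have hiuv : Integrable (fun z : Θ × Θ => dist xbar (u z.1) + dist xbar (v z.2)) γ :=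
    hiu'.add hiv'
  have hwint : Integrable
      (fun z : Θ × Θ => 1 + β * (dist xbar (u z.1) + dist xbar (v z.2))) γ :=
    (integrable_const _).add (hiuv.const_mul β)
  have hwle : ∫ z, (1 + β * (dist xbar (u z.1) + dist xbar (v z.2))) ∂γ
      ≤ 1 + β * (2 * c + α * (d₁ + d₂)) := by
    rw [integral_add (integrable_const _) (hiuv.const_mul β), integral_const_mul,
      integral_add hiu' hiv', hfst (h := fun θ => dist xbar (u θ)) (measurable_const.dist hu),
      hsnd (h := fun θ => dist xbar (v θ)) (measurable_const.dist hv)]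
    simp only [integral_const, probReal_univ, smul_eq_mul, mul_one]
    nlinarith
  have hgint : Integrable (fun z : Θ × Θ => G (dist (u z.1) (v z.2))) γ :=
    integrable_of_abs_le (hG.measurable.comp (hu'.dist hv')) (M := 1) fun z => by
      rw [abs_of_nonneg (hG.nonneg _ dist_nonneg)]; exact hG.le_one _ dist_nonneg
  have hsub : ∫ θ, f (u θ) ∂μ - ∫ θ, f (v θ) ∂ν = ∫ z, (f (u z.1) - f (v z.2)) ∂γ := by
    have h1 : Integrable (fun z : Θ × Θ => f (u z.1)) γ :=
      integrable_of_abs_le (hf.comp hu') fun _ => hM _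
    have h2 : Integrable (fun z : Θ × Θ => f (v z.2)) γ :=
      integrable_of_abs_le (hf.comp hv') fun _ => hM _
    rw [integral_sub h1 h2, hfst (h := fun θ => f (u θ)) (hf.comp hu),
      hsnd (h := fun θ => f (v θ)) (hf.comp hv)]
  have hmain {a b : ℝ} (h1 : ∫ z, G (dist (u z.1) (v z.2)) ∂γ ≤ a * G D)
      (h2 : 1 + β * (2 * c + α * (d₁ + d₂)) ≤ b * (1 + β * (d₁ + d₂))) :=
    abs_integral_le_of_abs_le_sqrt_mul hA hGD hW hgint hwint
      (fun _ => hG.nonneg _ dist_nonneg) (fun _ => by positivity)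
      (fun z => hfG (u z.1) (v z.2)) h1 (hwle.trans h2)
  rw [hsub]
  rcases le_or_gt D R with hDR | hDR
  · convert hmain (hG2 hDR) (hnear _ hU) using 3
    ring
  · convert hmain (a := 1) (by linarith) (hfar _ (hDR.trans_le hDd)) using 3
    ring

end OneStep

section PlaceDependent

/-- The weight `β` and the rate `q` for which the weighted gauge is contracted both at distances
below `R = (2 * c + 1) / (1 - α)` and above. -/
theorem exists_weight_rate {α s c : ℝ} (hα : α ∈ Set.Ioo (0 : ℝ) 1) (hs : s ∈ Set.Ioo (0 : ℝ) 1)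
    (hc : 0 ≤ c) :
    ∃ β q : ℝ, 0 ≤ β ∧ β ≤ 1 ∧ q ∈ Set.Ioo (0 : ℝ) 1 ∧
      (∀ U, 0 ≤ U → 1 + β * (2 * c + α * U) ≤ (2 * q - 1 + s) * (1 + β * U)) ∧
      ∀ U, (2 * c + 1) / (1 - α) < U → 1 + β * (2 * c + α * U) ≤ (2 * q - 1) * (1 + β * U) := by
  obtain ⟨hα0, hα1⟩ := hα
  obtain ⟨hs0, hs1⟩ := hs
  have hα' : 0 < 1 - α := by linarith
  set R : ℝ := (2 * c + 1) / (1 - α) with hR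
  have hR0 : 0 < R := by positivity
  have hRα : (1 - α) * R = 2 * c + 1 := by rw [hR]; field_simp
  set β : ℝ := s / (4 * c + 4) with hβ
  have hβ0 : 0 < β := by positivity
  have hβc : β * (4 * c + 4) = s := by rw [hβ]; field_simp
  have hβ1 : β < 1 := by nlinarith
  set η : ℝ := β / (1 + β * R) with hη
  have hη0 : 0 < η := by positivity
  have hηβ : η * (1 + β * R) = β := by rw [hη]; field_simp
  have hη1 : η < 1 := by nlinarith [mul_pos hη0 (mul_pos hβ0 hR0)]
  set q : ℝ := max (1 - s / 4) (1 - η / 2) with hq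
  have hq1 : 1 - s / 4 ≤ q := le_max_left _ _
  have hq2 : 1 - η / 2 ≤ q := le_max_right _ _
  refine ⟨β, q, hβ0.le, hβ1.le, ⟨by linarith, max_lt (by linarith) (by linarith)⟩,
    fun U hU => ?_, fun U hU => ?_⟩
  · have h1 : 0 ≤ β * U := by positivity
    have h2 : (1 + s / 2) * (1 + β * U) ≤ (2 * q - 1 + s) * (1 + β * U) :=
      mul_le_mul_of_nonneg_right (by linarith) (by linarith)
    nlinarith [mul_nonneg h1 hα'.le, mul_nonneg h1 hs0.le]
  · have h1 : 0 < β * U := mul_pos hβ0 (hR0.trans hU)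
    have h2 : (1 - η) * (1 + β * U) ≤ (2 * q - 1) * (1 + β * U) :=
      mul_le_mul_of_nonneg_right (by linarith) (by linarith)
    refine le_trans ?_ h2
    have h3 : η * (1 + β * U) ≤ β + η * β * (U - R) := by nlinarith
    have h4 : η * β ≤ β * (1 - α) := by
      have h5 : η ≤ 1 - α := by
        have h6 : η * (β * R) ≤ β := by nlinarith
        have h7 : η * R ≤ 1 := by nlinarith
        nlinarith
      nlinarith
    nlinarith [mul_le_mul_of_nonneg_right h4 (sub_nonneg.2 hU.le)]

variable {X Θ : Type*} [MeasurableSpace Θ]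

theorem measurable_map_of_measurable_uncurry [MeasurableSpace X] {S : Θ → X → X}
    (hS : Measurable (Function.uncurry S)) {ϑ : X → Measure Θ} [∀ x, IsProbabilityMeasure (ϑ x)]
    (hϑ : Measurable ϑ) : Measurable fun x => (ϑ x).map fun θ => S θ x := by
  have hSx (x : X) : Measurable fun θ => S θ x := hS.comp measurable_prodMk_right
  let η : Kernel X Θ := ⟨ϑ, hϑ⟩
  have : IsMarkovKernel η := ⟨fun x => inferInstanceAs (IsProbabilityMeasure (ϑ x))⟩
  refine Measure.measurable_of_measurable_coe _ fun A hA => ?_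
  simp_rw [Measure.map_apply (hSx _) hA]
  exact Kernel.measurable_kernel_prodMk_left (κ := η) ((hS.comp measurable_swap) hA)

variable [MetricSpace X]

theorem IsFMTest.abs_sub_le_sqrt {f : X → ℝ} (hf : IsFMTest f) {c : ℝ} (hc : 0 < c) {G W : ℝ}
    (hW : 1 ≤ W) {x y : X} (hG : c * min 1 (dist x y) ^ 2 ≤ G) :
    |f x - f y| ≤ 2 / √c * √(G * W) := by
  have hc' : 0 < √c := Real.sqrt_pos.2 hc
  have hm : 0 ≤ min 1 (dist x y) := le_min zero_le_one dist_nonneg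
  have h0 : 0 ≤ G := le_trans (by positivity) hG
  have h1 : |f x - f y| ≤ 2 * min 1 (dist x y) := by
    have h2 : |f x - f y| ≤ 2 := (abs_sub _ _).trans (by
      linarith [hf.abs_le_one x, hf.abs_le_one y])
    have h3 := hf.abs_sub_le x y
    rcases min_choice 1 (dist x y) with h | h <;> rw [h] <;>
      linarith [dist_nonneg (x := x) (y := y)]
  have h2 : √c * min 1 (dist x y) ≤ √(G * W) := by
    refine Real.le_sqrt_of_sq_le ?_
    rw [mul_pow, Real.sq_sqrt hc.le]
    nlinarith
  rw [div_mul_eq_mul_div, le_div_iff₀ hc']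
  nlinarith

variable [MeasurableSpace X] [BorelSpace X]

theorem measurable_of_tvNorm_le {ϑ : X → Measure Θ} [∀ x, IsProbabilityMeasure (ϑ x)] {l p : ℝ}
    (hp : 0 < p) (h : ∀ x y, tvNorm (ϑ x) (ϑ y) ≤ l * dist x y ^ p) : Measurable ϑ := by
  refine Measure.measurable_of_measurable_coe _ fun A hA => ?_
  have hcont : Continuous fun x => (ϑ x).real A := by
    refine continuous_iff_continuousAt.2 fun x => tendsto_iff_dist_tendsto_zero.2 ?_
    refine squeeze_zero (g := fun y => l * dist y x ^ p) (fun _ => dist_nonneg) (fun y => ?_) ?_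
    · rw [Real.dist_eq]
      exact (abs_measureReal_sub_le_tvNorm _ _ hA).trans (h y x)
    · have h1 : Continuous fun y => l * dist y x ^ p :=
        continuous_const.mul ((continuous_id.dist continuous_const).rpow_const
          fun _ => Or.inr hp.le)
      simpa [Real.zero_rpow hp.ne'] using h1.tendsto x
  have h1 : (fun x => ϑ x A) = fun x => ENNReal.ofReal ((ϑ x).real A) :=
    funext fun x => (ofReal_measureReal (μ := ϑ x) (s := A)).symm
  rw [h1]
  exact hcont.measurable.ennreal_ofReal

theorem lintegral_dist_le_add {S : Θ → X → X} (hS : Measurable (Function.uncurry S))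
    {μ : Measure Θ} {xbar x : X} {a c : ℝ} (ha : 0 ≤ a) (hc : 0 ≤ c)
    (h₁ : ∫⁻ θ, ENNReal.ofReal (dist (S θ x) (S θ xbar)) ∂μ ≤ ENNReal.ofReal a)
    (h₂ : ∫⁻ θ, ENNReal.ofReal (dist (S θ xbar) xbar) ∂μ ≤ ENNReal.ofReal c) :
    ∫⁻ θ, ENNReal.ofReal (dist xbar (S θ x)) ∂μ ≤ ENNReal.ofReal (a + c) := by
  have hm : Measurable fun θ => dist (S θ xbar) xbar :=
    (continuous_id.dist continuous_const).measurable.comp (hS.comp measurable_prodMk_right)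
  rw [ENNReal.ofReal_add ha hc]
  refine le_trans ?_ (add_le_add h₁ h₂)
  rw [← lintegral_add_right _ hm.ennreal_ofReal]
  refine lintegral_mono fun θ => ?_
  rw [← ENNReal.ofReal_add dist_nonneg dist_nonneg]
  refine ENNReal.ofReal_le_ofReal ?_
  rw [dist_comm xbar]
  exact dist_triangle _ _ _

end PlaceDependent

theorem random_iteration_place_dependent
    {X : Type*} [MetricSpace X] [CompleteSpace X] [SecondCountableTopology X]
    [MeasurableSpace X] [BorelSpace X]
    {Θ : Type*} [MeasurableSpace Θ]
    -- the family of continuous functions S_θ, jointly measurable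
    (S : Θ → X → X) (hScont : ∀ θ, Continuous (S θ))
    (hSmeas : Measurable (Function.uncurry S))
    -- the place dependent probabilities ϑ_x
    (ϑ : X → Measure Θ) (hϑ : ∀ x, IsProbabilityMeasure (ϑ x))
    -- B1
    (α : ℝ) (hα : α ∈ Set.Ioo (0:ℝ) 1)
    (hB1 : ∀ x y : X, ∫⁻ θ, ENNReal.ofReal (dist (S θ x) (S θ y)) ∂ϑ x
      ≤ ENNReal.ofReal (α * dist x y))
    -- B2
    (xbar : X) (c : ℝ)
    (hB2 : ∀ x : X, ∫⁻ θ, ENNReal.ofReal (dist (S θ xbar) xbar) ∂ϑ x ≤ ENNReal.ofReal c)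
    -- B3 : Hölder continuity of x ↦ ϑ_x in the total variation norm
    (l nu : ℝ) (hl : 0 < l) (hnu : nu ∈ Set.Ioc (0:ℝ) 1)
    (hB3 : ∀ x y : X, tvNorm (ϑ x) (ϑ y) ≤ l * dist x y ^ nu)
    -- B4
    (δ : ℝ) (hδ : 0 < δ)
    (hB4 : ∀ x y : X, ENNReal.ofReal δ <
      (ϑ x ⊓ ϑ y) {θ : Θ | dist (S θ x) (S θ y) ≤ α * dist x y}) :
    -- conclusion: a unique, exponentially attractive invariant measure μ* ∈ M₁¹(X)
    ∃ μstar : Measure X, IsProbabilityMeasure μstar ∧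
      (∫⁻ x, ENNReal.ofReal (dist xbar x) ∂μstar < ⊤) ∧
      μstar.bind (fun x => (ϑ x).map (fun θ => S θ x)) = μstar ∧
      (∀ μ' : Measure X, IsProbabilityMeasure μ' →
        (∫⁻ x, ENNReal.ofReal (dist xbar x) ∂μ' < ⊤) →
        μ'.bind (fun x => (ϑ x).map (fun θ => S θ x)) = μ' → μ' = μstar) ∧
      (∀ μ : Measure X, IsProbabilityMeasure μ →
        ∀ f : X → ℝ, Continuous f → (∃ M, ∀ x, |f x| ≤ M) →
        Tendsto (fun n => ∫ x, ((fun (g : X → ℝ) x => ∫ θ, g (S θ x) ∂ϑ x)^[n] f) x ∂μ)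
          atTop (nhds (∫ x, f x ∂μstar))) ∧
      ∃ q C : ℝ, q ∈ Set.Ioo (0:ℝ) 1 ∧ 0 < C ∧
        ∀ μ : Measure X, IsProbabilityMeasure μ →
          (∫⁻ x, ENNReal.ofReal (dist xbar x) ∂μ < ⊤) → ∀ n : ℕ,
          fmDist ((fun m : Measure X => m.bind (fun x => (ϑ x).map (fun θ => S θ x)))^[n] μ)
              μstar
            ≤ q ^ n * C * (1 + ∫ x, dist xbar x ∂μ) := by
  have hα0 : 0 ≤ α := hα.1.le
  have hSx (x : X) : Measurable fun θ => S θ x := hSmeas.comp measurable_prodMk_right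
  have hδ1 : δ < 1 := by
    have h1 : ENNReal.ofReal δ < 1 := (hB4 xbar xbar).trans_le
      (((Measure.le_iff'.1 inf_le_left) _).trans prob_le_one)
    exact ENNReal.ofReal_lt_one.1 h1
  have hlyap (x : X) : ∫⁻ θ, ENNReal.ofReal (dist xbar (S θ x)) ∂ϑ x
      ≤ ENNReal.ofReal (α * dist xbar x + max c 0) := by
    refine lintegral_dist_le_add hSmeas (mul_nonneg hα0 dist_nonneg) (le_max_right c 0) ?_
      ((hB2 x).trans (ENNReal.ofReal_le_ofReal (le_max_left c 0)))
    rw [dist_comm xbar]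
    exact hB1 x xbar
  have hc : 0 ≤ max c 0 := le_max_right c 0
  obtain ⟨G, K, s, cG, hK, hs, hcG, hG, hGlow⟩ := exists_isContractionGauge
    (R := (2 * max c 0 + 1) / (1 - α)) hα hl hnu ⟨hδ, hδ1⟩
  obtain ⟨β, q, hβ0, hβ1, hq, hnear, hfar⟩ := exists_weight_rate hα hs hc
  let κ : Kernel X X := ⟨fun x => (ϑ x).map fun θ => S θ x,
    measurable_map_of_measurable_uncurry hSmeas (measurable_of_tvNorm_le hnu.1 hB3)⟩
  have hκ : IsMarkovKernel κ :=
    ⟨fun x => Measure.isProbabilityMeasure_map (hSx x).aemeasurable⟩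
  have hκint {f : X → ℝ} (hf : Measurable f) (x : X) :
      markovOp κ f x = ∫ θ, f (S θ x) ∂ϑ x :=
    integral_map (hSx x).aemeasurable hf.aestronglyMeasurable
  have hW (x y : X) : 1 ≤ 1 + β * (dist xbar x + dist xbar y) :=
    le_add_of_nonneg_right (by positivity)
  have hW' (x y : X) : 1 + β * (dist xbar x + dist xbar y) ≤ 1 + dist xbar x + dist xbar y := by
    have h1 : 0 ≤ dist xbar x + dist xbar y := by positivity
    nlinarith
  have hstep {f : X → ℝ} (hf : Measurable f) (hf1 : ∀ x, |f x| ≤ 1) {A : ℝ} (hA : 0 ≤ A)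
      (hfG : ∀ x y, |f x - f y|
        ≤ A * √(G (dist x y) * (1 + β * (dist xbar x + dist xbar y)))) (x y : X) :
      |markovOp κ f x - markovOp κ f y|
        ≤ A * q * √(G (dist x y) * (1 + β * (dist xbar x + dist xbar y))) := by
    rcases eq_or_ne x y with rfl | hxy
    · have := hq.1.le
      rw [sub_self, abs_zero]
      positivity
    · have hGD : 0 < G (dist x y) := lt_of_lt_of_le
        (mul_pos hcG (pow_pos (lt_min one_pos (dist_pos.2 hxy)) 2)) (hGlow _ dist_nonneg)
      rw [hκint hf, hκint hf]
      exact abs_integral_sub_integral_le (hSx x) (hSx y) hG hnu hα0 hK.le dist_nonneg hGD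
        (hB1 x y) (hB3 x y) (hB4 x y) hc hβ0 dist_nonneg dist_nonneg
        (dist_triangle_left x y xbar) (hlyap x) (hlyap y) hnear hfar hf hf1 hA hfG
  have htest {f : X → ℝ} (hf : IsFMTest f) (x y : X) : |f x - f y|
      ≤ 2 / √cG * √(G (dist x y) * (1 + β * (dist xbar x + dist xbar y))) :=
    hf.abs_sub_le_sqrt hcG (hW x y) (hGlow _ dist_nonneg)
  have hA : 0 < 2 / √cG := div_pos two_pos (Real.sqrt_pos.2 hcG)
  have hiter {f : X → ℝ} (hf : IsFMTest f) (n : ℕ) (x y : X) :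
      |(markovOp κ)^[n] f x - (markovOp κ)^[n] f y|
        ≤ 2 / √cG * q ^ n * √(G (dist x y) * (1 + β * (dist xbar x + dist xbar y))) := by
    induction n generalizing x y with
    | zero => simpa using htest hf x y
    | succ n ih =>
      rw [Function.iterate_succ_apply', pow_succ, ← mul_assoc]
      exact hstep (measurable_iterate_markovOp κ hf.continuous.measurable n)
        (abs_iterate_markovOp_le κ hf.abs_le_one n)
        (mul_nonneg hA.le (pow_nonneg hq.1.le n)) ih x y
  have hcontr (f : X → ℝ) (hf : IsFMTest f) (n : ℕ) (x y : X) :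
      |(markovOp κ)^[n] f x - (markovOp κ)^[n] f y|
        ≤ 2 / √cG * q ^ n * (1 + dist xbar x + dist xbar y) := by
    refine (hiter hf n x y).trans (mul_le_mul_of_nonneg_left ?_
      (mul_nonneg hA.le (pow_nonneg hq.1.le n)))
    have h1 := hW x y
    have h2 := hG.le_one _ (dist_nonneg (x := x) (y := y))
    refine (Real.sqrt_le_iff.2 ⟨by linarith, ?_⟩).trans (hW' x y)
    nlinarith
  have hcont (f : X → ℝ) (hf : IsFMTest f) : Continuous (markovOp κ f) := by
    refine continuous_iff_continuousAt.2 fun x => tendsto_iff_dist_tendsto_zero.2 ?_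
    refine squeeze_zero (g := fun y => 2 / √cG * q
        * √(K * dist y x ^ nu * (1 + β * (dist xbar y + dist xbar x))))
      (fun _ => dist_nonneg) (fun y => ?_) ?_
    · rw [Real.dist_eq]
      refine (hstep hf.continuous.measurable hf.abs_le_one hA.le (htest hf) y x).trans ?_
      refine mul_le_mul_of_nonneg_left (Real.sqrt_le_sqrt ?_) (mul_nonneg hA.le hq.1.le)
      exact mul_le_mul_of_nonneg_right (hG.le_rpow _ dist_nonneg)
        (zero_le_one.trans (hW y x))
    · have h1 : Continuous fun y => 2 / √cG * q
          * √(K * dist y x ^ nu * (1 + β * (dist xbar y + dist xbar x))) := by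
        have h2 : Continuous fun y => dist y x ^ nu :=
          (continuous_id.dist continuous_const).rpow_const fun _ => Or.inr hnu.1.le
        fun_prop
      simpa [Real.zero_rpow hnu.1.ne'] using h1.tendsto x
  have hlyapκ (x : X) : ∫⁻ y, ENNReal.ofReal (dist xbar y) ∂κ x
      ≤ ENNReal.ofReal (α * dist xbar x + max c 0) := by
    refine le_of_eq_of_le (lintegral_map ?_ (hSx x)) (hlyap x)
    fun_prop
  obtain ⟨μstar, hμ, hmom, hinv, huniq, hattr, C, hC, hrate⟩ :=
    exists_invariant_of_contraction κ hα0 hα.2 hc hA hq hlyapκ hcont hcontr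
  refine ⟨μstar, hμ, hmom, hinv, fun μ' h1 _ h2 => huniq μ' h1 h2, fun μ h1 f hf hM => ?_,
    q, C, hq, hC, hrate⟩
  refine (hattr μ h1 f hf hM).congr fun n => ?_
  suffices h : (markovOp κ)^[n] f = (fun (g : X → ℝ) x => ∫ θ, g (S θ x) ∂ϑ x)^[n] f by rw [h]
  induction n with
  | zero => rfl
  | succ n ih =>
    rw [Function.iterate_succ_apply', Function.iterate_succ_apply', ← ih]
    exact funext (hκint (measurable_iterate_markovOp κ hf.measurable n))

end
end
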